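/- arXiv:1808.02273 — 11 statements merged into one kernel-verified Lean document; each statement's English description precedes it below -/
import Mathlib

section
/- Let t, p, b, x be integers with t ≥ p ≥ 2, b ≥ p, b > (p-1)(t+1), and x ≥ 1 such that C(b, p-1) · ((p-1)/b)^(t·x) < 1. Then for every t-intersecting hypergraph G on a finite vertex set V there exist x functions h_1, …, h_x : V → [b] such that for every hyperedge e of G there is some index i with |h_i(e)| ≥ p; equivalently, λ(t,p,b) ≤ x. -/
/-- `G` is a `t`-intersecting hypergraph: any two hyperedges share at least `t` vertices. -/
def IsIntersecting {V : Type*} [DecidableEq V] (t : ℕ) (G : Finset (Finset V)) : Prop :=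
  ∀ e₁ ∈ G, ∀ e₂ ∈ G, t ≤ (e₁ ∩ e₂).card

theorem even_card_of_fixedPointFree_involution {α : Type*} (s : Finset α) (g : α → α)
    (hmem : ∀ a ∈ s, g a ∈ s) (hne : ∀ a ∈ s, g a ≠ a) (hinv : ∀ a ∈ s, g (g a) = a) :
    Even s.card := by
  have h : ∑ _a ∈ s, (1 : ZMod 2) = 0 :=
    Finset.sum_involution (fun a _ => g a) (fun _ _ => by decide) (fun a ha _ => hne a ha)
      hmem hinv
  rw [Finset.sum_const, nsmul_one] at h
  exact (ZMod.natCast_eq_zero_iff_even).1 h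

/-- The `j`-th vertex of the Kuhn simplex with base point `z` and coordinate order `ρ`. -/
def kuhnVertex {d : ℕ} (z : Fin d → ℤ) (ρ : Equiv.Perm (Fin d)) (j : ℕ) : Fin d → ℤ :=
  fun k => z k + if (ρ k : ℕ) < j then 1 else 0

/-- The facet opposite to vertex `i` of a Kuhn simplex carries all labels below `d`. -/
def IsDoor {d : ℕ} (L : (Fin d → ℤ) → ℕ) (s : (Fin d → ℤ) × Equiv.Perm (Fin d) × ℕ) : Prop :=
  s.2.2 ≤ d ∧ ∀ c < d, ∃ j ≤ d, j ≠ s.2.2 ∧ L (kuhnVertex s.1 s.2.1 j) = c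

theorem image_erase_eq_range {d i : ℕ} {f : ℕ → ℕ} (hi : i ≤ d)
    (hf : ∀ c < d, ∃ j ≤ d, j ≠ i ∧ f j = c) :
    ((Finset.range (d + 1)).erase i).image f = Finset.range d ∧
      Set.InjOn f ((Finset.range (d + 1)).erase i) := by
  have hcard : ((Finset.range (d + 1)).erase i).card = d := by
    rw [Finset.card_erase_of_mem (by simpa using Nat.lt_succ_of_le hi)]; simp
  have hsub : Finset.range d ⊆ ((Finset.range (d + 1)).erase i).image f := by
    intro c hc
    obtain ⟨j, hj, hji, rfl⟩ := hf c (Finset.mem_range.1 hc)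
    exact Finset.mem_image_of_mem _ (by simp [hji]; omega)
  have heq : Finset.range d = ((Finset.range (d + 1)).erase i).image f :=
    Finset.eq_of_subset_of_card_le hsub (by
      simpa [hcard] using Finset.card_image_le (s := (Finset.range (d + 1)).erase i) (f := f))
  refine ⟨heq.symm, Finset.card_image_iff.1 ?_⟩
  rw [← heq, hcard, Finset.card_range]

namespace IsDoor

variable {d : ℕ} {L : (Fin d → ℤ) → ℕ} {z : Fin d → ℤ} {ρ : Equiv.Perm (Fin d)} {i j j' : ℕ}

theorem label_lt (h : IsDoor L (z, ρ, i)) (hj : j ≤ d) (hji : j ≠ i) :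
    L (kuhnVertex z ρ j) < d := by
  have := (image_erase_eq_range (f := fun j => L (kuhnVertex z ρ j)) h.1 h.2).1
  exact Finset.mem_range.1 (this ▸ Finset.mem_image_of_mem
    (fun j => L (kuhnVertex z ρ j)) (by simp [hji]; omega))

theorem label_inj (h : IsDoor L (z, ρ, i)) (hj : j ≤ d) (hji : j ≠ i) (hj' : j' ≤ d)
    (hji' : j' ≠ i) (heq : L (kuhnVertex z ρ j) = L (kuhnVertex z ρ j')) : j = j' :=
  (image_erase_eq_range (f := fun j => L (kuhnVertex z ρ j)) h.1 h.2).2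
    (by simp [hji]; omega) (by simp [hji']; omega) heq

/-- A second vertex with the label of vertex `i` also lies opposite to a door. -/
theorem exchange (h : IsDoor L (z, ρ, i)) (hj : j ≤ d) (hji : j ≠ i)
    (heq : L (kuhnVertex z ρ j) = L (kuhnVertex z ρ i)) : IsDoor L (z, ρ, j) := by
  refine ⟨hj, fun c hc => ?_⟩
  obtain ⟨k, hk, hki, hkc⟩ := h.2 c hc
  by_cases hkj : k = j
  · exact ⟨i, h.1, hji.symm, by rw [← heq, ← hkj]; exact hkc⟩
  · exact ⟨k, hk, hkj, hkc⟩

end IsDoor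

theorem coe_finRotate_eq {m : ℕ} (x : Fin (m + 1)) :
    (finRotate (m + 1) x : ℕ) = if (x : ℕ) = m then 0 else (x : ℕ) + 1 := by
  split_ifs with h
  · have : x = Fin.last m := Fin.ext h
    simp [this]
  · exact coe_finRotate_of_ne_last (fun h' => h (by simp [h']))

theorem coe_finRotate_symm_eq {m : ℕ} (x : Fin (m + 1)) :
    ((finRotate (m + 1)).symm x : ℕ) = if (x : ℕ) = 0 then m else (x : ℕ) - 1 := by
  obtain ⟨y, rfl⟩ := (finRotate (m + 1)).surjective x
  rw [Equiv.symm_apply_apply, coe_finRotate_eq]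
  have := y.2
  split_ifs <;> simp_all

/-- The Kuhn simplex on the other side of the facet opposite to vertex `i`. -/
def kuhnFlip {m : ℕ} (s : (Fin (m + 1) → ℤ) × Equiv.Perm (Fin (m + 1)) × ℕ) :
    (Fin (m + 1) → ℤ) × Equiv.Perm (Fin (m + 1)) × ℕ :=
  if s.2.2 = 0 then
    (fun k => s.1 k + if (s.2.1 k : ℕ) = 0 then 1 else 0,
      s.2.1.trans (finRotate (m + 1)).symm, m + 1)
  else if h : s.2.2 < m + 1 then
    (s.1, s.2.1.trans (Equiv.swap ⟨s.2.2 - 1, by omega⟩ ⟨s.2.2, h⟩), s.2.2)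
  else
    (fun k => s.1 k - if (s.2.1 k : ℕ) = m then 1 else 0, s.2.1.trans (finRotate (m + 1)), 0)

section Flip

variable {m : ℕ} {L : (Fin (m + 1) → ℤ) → ℕ} {z : Fin (m + 1) → ℤ}
  {ρ : Equiv.Perm (Fin (m + 1))} {i j : ℕ}

theorem kuhnVertex_shift_up (hj : j ≤ m) :
    kuhnVertex (fun k => z k + if (ρ k : ℕ) = 0 then 1 else 0)
      (ρ.trans (finRotate (m + 1)).symm) j = kuhnVertex z ρ (j + 1) := by
  ext k
  have := (ρ k).2
  simp only [kuhnVertex, Equiv.trans_apply, coe_finRotate_symm_eq]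
  split_ifs <;> omega

theorem kuhnVertex_shift_down (hj : j ≤ m) :
    kuhnVertex (fun k => z k - if (ρ k : ℕ) = m then 1 else 0)
      (ρ.trans (finRotate (m + 1))) (j + 1) = kuhnVertex z ρ j := by
  ext k
  have := (ρ k).2
  simp only [kuhnVertex, Equiv.trans_apply, coe_finRotate_eq]
  split_ifs <;> omega

theorem coe_swap_eq {n a : ℕ} (h : a < n) (x : Fin n) :
    (Equiv.swap (⟨a - 1, by omega⟩ : Fin n) ⟨a, h⟩ x : ℕ) =
      if (x : ℕ) = a - 1 then a else if (x : ℕ) = a then a - 1 else x := by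
  simp only [Equiv.swap_apply_def, Fin.ext_iff]
  split_ifs <;> rfl

theorem kuhnVertex_swap (hi : i < m + 1) (hji : j ≠ i) :
    kuhnVertex z (ρ.trans (Equiv.swap ⟨i - 1, by omega⟩ ⟨i, hi⟩)) j = kuhnVertex z ρ j := by
  ext k
  simp only [kuhnVertex, Equiv.trans_apply, coe_swap_eq hi]
  split_ifs <;> omega

theorem IsDoor.kuhnFlip (h : IsDoor L (z, ρ, i)) : IsDoor L (kuhnFlip (z, ρ, i)) := by
  obtain ⟨hi, h⟩ := h
  simp only at hi h
  unfold _root_.kuhnFlip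
  dsimp only
  split_ifs with h0 h1
  · refine ⟨le_rfl, fun c hc => ?_⟩
    obtain ⟨j, hj, hji, hjc⟩ := h c hc
    refine ⟨j - 1, by omega, by simp only; omega, ?_⟩
    rw [kuhnVertex_shift_up (by omega), Nat.sub_add_cancel (by omega)]
    exact hjc
  · refine ⟨hi, fun c hc => ?_⟩
    obtain ⟨j, hj, hji, hjc⟩ := h c hc
    refine ⟨j, hj, hji, ?_⟩
    rw [kuhnVertex_swap h1 hji]
    exact hjc
  · refine ⟨Nat.zero_le _, fun c hc => ?_⟩
    obtain ⟨j, hj, hji, hjc⟩ := h c hc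
    refine ⟨j + 1, by omega, by simp, ?_⟩
    rw [kuhnVertex_shift_down (by omega)]
    exact hjc

theorem kuhnFlip_ne : kuhnFlip (z, ρ, i) ≠ (z, ρ, i) := by
  unfold kuhnFlip
  dsimp only
  split_ifs with h0 h1
  · intro h
    have := congrArg (fun s => s.2.2) h
    simp only at this
    omega
  · intro h
    have h2 := congrArg (fun s => ((s.2.1 (ρ.symm ⟨i, h1⟩) : Fin (m + 1)) : ℕ)) h
    simp at h2
    omega
  · intro h
    have := congrArg (fun s => s.2.2) h
    simp only at this
    omega

theorem kuhnFlip_kuhnFlip (hi : i ≤ m + 1) : kuhnFlip (kuhnFlip (z, ρ, i)) = (z, ρ, i) := by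
  by_cases h0 : i = 0
  · subst h0
    simp only [kuhnFlip, if_true, if_neg (Nat.succ_ne_zero m), lt_irrefl, dite_false,
      Prod.mk.injEq]
    refine ⟨?_, ?_, trivial⟩
    · ext k
      have := (ρ k).2
      simp only [Equiv.trans_apply, coe_finRotate_symm_eq]
      split_ifs <;> omega
    · ext k; simp
  by_cases h1 : i < m + 1
  · simp only [kuhnFlip, if_neg h0, dif_pos h1, Prod.mk.injEq]
    refine ⟨trivial, ?_, trivial⟩
    ext k; simp
  · obtain rfl : i = m + 1 := by omega
    simp only [kuhnFlip, if_true, if_neg h0, dif_neg h1, Prod.mk.injEq]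
    refine ⟨?_, ?_, trivial⟩
    · ext k
      simp only [Equiv.trans_apply, coe_finRotate_eq]
      by_cases h : (ρ k : ℕ) = m <;> simp [h]
    · ext k; simp

/-- If the labels below `d` occur in a bounded region only, the number of doors whose opposite
vertex does not carry a label below `d` is even. -/
theorem exists_even_doors {B : ℤ} (hB : ∀ z, L z < m + 1 → ∀ k, 0 ≤ z k ∧ z k ≤ B) :
    ∃ T : Finset ((Fin (m + 1) → ℤ) × Equiv.Perm (Fin (m + 1)) × ℕ), Even T.card ∧
      ∀ z ρ i, (z, ρ, i) ∈ T ↔ IsDoor L (z, ρ, i) ∧ m + 1 ≤ L (kuhnVertex z ρ i) := by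
  classical
  set T := ((Fintype.piFinset fun _ : Fin (m + 1) => Finset.Icc (-1) B) ×ˢ
    (Finset.univ : Finset (Equiv.Perm (Fin (m + 1)))) ×ˢ Finset.range (m + 2)).filter
      (IsDoor L) with hT
  have hmem : ∀ s, s ∈ T ↔ IsDoor L s := by
    rintro ⟨z, ρ, i⟩
    simp only [hT, Finset.mem_filter, Finset.mem_product, Fintype.mem_piFinset,
      Finset.mem_Icc, Finset.mem_univ, Finset.mem_range, true_and, and_iff_right_iff_imp]
    intro h
    obtain ⟨j, hj, hji, hj0⟩ := h.2 0 (by omega)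
    have hb := hB _ (hj0.trans_lt (by omega))
    refine ⟨fun k => ?_, Nat.lt_succ_of_le h.1⟩
    have := hb k
    simp only [kuhnVertex] at this
    split_ifs at this <;> omega
  have hTeven : Even T.card := by
    apply even_card_of_fixedPointFree_involution T kuhnFlip
    · rintro ⟨z, ρ, i⟩ h
      exact (hmem _).2 ((hmem _).1 h).kuhnFlip
    · rintro ⟨z, ρ, i⟩ -
      exact kuhnFlip_ne
    · rintro ⟨z, ρ, i⟩ h
      exact kuhnFlip_kuhnFlip ((hmem _).1 h).1
  set P : (Fin (m + 1) → ℤ) × Equiv.Perm (Fin (m + 1)) × ℕ → Prop :=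
    fun s => L (kuhnVertex s.1 s.2.1 s.2.2) < m + 1
  have hpartner : ∀ s, ∃ j, s ∈ T.filter P → j ≤ m + 1 ∧ j ≠ s.2.2 ∧
      L (kuhnVertex s.1 s.2.1 j) = L (kuhnVertex s.1 s.2.1 s.2.2) := by
    intro s
    by_cases hs : s ∈ T.filter P
    · rw [Finset.mem_filter, hmem] at hs
      obtain ⟨j, hj⟩ := hs.1.2 _ hs.2
      exact ⟨j, fun _ => hj⟩
    · exact ⟨0, fun h => absurd h hs⟩
  choose partner hpartner using hpartner
  have hmem' : ∀ s ∈ T.filter P, (s.1, s.2.1, partner s) ∈ T.filter P := by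
    rintro ⟨z, ρ, i⟩ hs
    obtain ⟨h1, h2, h3⟩ := hpartner _ hs
    rw [Finset.mem_filter, hmem] at hs ⊢
    exact ⟨hs.1.exchange h1 h2 h3, h3.trans_lt hs.2⟩
  have hPeven : Even (T.filter P).card := by
    apply even_card_of_fixedPointFree_involution _ (fun s => (s.1, s.2.1, partner s)) hmem'
    · rintro s hs h
      exact (hpartner s hs).2.1 (congrArg (fun s => s.2.2) h)
    · rintro ⟨z, ρ, i⟩ hs
      have hs' := hmem' _ hs
      obtain ⟨h1, h2, h3⟩ := hpartner _ hs
      obtain ⟨h1', h2', h3'⟩ := hpartner _ hs'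
      rw [Finset.mem_filter, hmem] at hs hs'
      simp only at h1 h2 h3 h1' h2' h3' hs' ⊢
      rw [hs'.1.label_inj h1' h2' hs.1.1 h2.symm (h3'.trans h3)]
  refine ⟨T.filter fun s => ¬ P s, ?_, fun z ρ i => ?_⟩
  · have := Finset.card_filter_add_card_filter_not (s := T) P
    rw [← this, Nat.even_add] at hTeven
    exact hTeven.1 hPeven
  · rw [Finset.mem_filter, hmem, not_lt]

end Flip

/-- The weakly increasing sequence `0, z 0, …, z (d - 1), N` of cut points of an integer interval
of length `N`. -/
def cut {d : ℕ} (N : ℤ) (z : Fin d → ℤ) : ℕ → ℤ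
  | 0 => 0
  | k + 1 => if h : k < d then z ⟨k, h⟩ else N

section Cut

variable {d : ℕ} {N N' : ℤ} {z z' : Fin d → ℤ} {c : ℕ}

@[simp] theorem cut_zero : cut N z 0 = 0 := rfl

theorem cut_succ (k : Fin d) : cut N z (k + 1) = z k := by simp [cut]

theorem cut_succ_of_le (h : d ≤ c) : cut N z (c + 1) = N := by simp [cut, h]

theorem cut_congr (h : c ≤ d) : cut N z c = cut N' z c := by
  cases c with
  | zero => rfl
  | succ c => rw [cut_succ ⟨c, h⟩, cut_succ ⟨c, h⟩]

theorem monotone_cut (h : ∀ c ≤ d, cut N z c ≤ cut N z (c + 1)) : Monotone (cut N z) := by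
  refine monotone_nat_of_le_succ fun c => ?_
  by_cases hc : c ≤ d
  · exact h c hc
  · obtain ⟨c, rfl⟩ : ∃ c', c = c' + 1 := ⟨c - 1, by omega⟩
    rw [cut_succ_of_le (by omega), cut_succ_of_le (by omega)]

theorem cut_le_cut (h : ∀ k, z k ≤ z' k) : cut N z c ≤ cut N z' c := by
  cases c with
  | zero => rfl
  | succ c =>
    simp only [cut]
    split_ifs
    exacts [h _, le_rfl]

theorem cut_le_cut_add_one (h : ∀ k, z' k ≤ z k + 1) : cut N z' c ≤ cut N z c + 1 := by
  cases c with
  | zero => simp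
  | succ c =>
    simp only [cut]
    split_ifs
    exacts [h _, by omega]

theorem monotone_cut_of_le (hz : Monotone (cut N z)) (h : N ≤ N') : Monotone (cut N' z) := by
  refine monotone_cut fun c hc => ?_
  have := hz (Nat.le_succ c)
  rcases hc.lt_or_eq with hc | rfl
  · rwa [cut_congr hc.le, cut_congr hc]
  · rw [cut_congr (N' := N) le_rfl, cut_succ_of_le le_rfl]
    rw [Nat.succ_eq_add_one, cut_succ_of_le le_rfl] at this
    exact this.trans h

end Cut

section KuhnVertex

variable {d : ℕ} {N : ℤ} {z : Fin d → ℤ} {ρ : Equiv.Perm (Fin d)} {i j c : ℕ}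

theorem kuhnVertex_mono (h : i ≤ j) (k : Fin d) : kuhnVertex z ρ i k ≤ kuhnVertex z ρ j k := by
  simp only [kuhnVertex]
  split_ifs <;> omega

theorem kuhnVertex_le_add_one (i j : ℕ) (k : Fin d) :
    kuhnVertex z ρ i k ≤ kuhnVertex z ρ j k + 1 := by
  simp only [kuhnVertex]
  split_ifs <;> omega

theorem cut_kuhnVertex_le_succ
    (h : cut N (kuhnVertex z ρ j) c < cut N (kuhnVertex z ρ j) (c + 1)) :
    cut N (kuhnVertex z ρ i) c ≤ cut N (kuhnVertex z ρ i) (c + 1) := by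
  rcases le_total i j with hij | hij
  · have h1 := cut_le_cut (N := N) (c := c) (kuhnVertex_mono (z := z) (ρ := ρ) hij)
    have h2 := cut_le_cut_add_one (N := N) (c := c + 1)
      (kuhnVertex_le_add_one (z := z) (ρ := ρ) j i)
    omega
  · have h1 := cut_le_cut (N := N) (c := c + 1) (kuhnVertex_mono (z := z) (ρ := ρ) hij)
    have h2 := cut_le_cut_add_one (N := N) (c := c)
      (kuhnVertex_le_add_one (z := z) (ρ := ρ) i j)
    omega

end KuhnVertex

open Classical in
/-- Extension of a labelling of the sequences with values in `[0, N]` to all integer points: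
sequences ending in `N + 1` are labelled by the position of their first positive increment. -/
noncomputable def extendLabel {m : ℕ} (N : ℤ) (ℓ : (Fin (m + 1) → ℤ) → ℕ)
    (z : Fin (m + 1) → ℤ) : ℕ :=
  if Monotone (cut N z) then ℓ z
  else if Monotone (cut (N + 1) z) then sInf {c | 0 < cut (N + 1) z (c + 1)}
  else m + 2

section Label

variable {m : ℕ} {N : ℤ} {ℓ : (Fin (m + 1) → ℤ) → ℕ} {z : Fin (m + 1) → ℤ} {c : ℕ}

theorem cut_last : cut N z (m + 1) = z (Fin.last m) := cut_succ (Fin.last m)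

theorem last_le_of_monotone (h : Monotone (cut N z)) : z (Fin.last m) ≤ N := by
  have := h (Nat.le_succ (m + 1))
  rwa [Nat.succ_eq_add_one, cut_succ_of_le le_rfl, cut_last] at this

theorem last_eq_of_not_monotone (h : ¬ Monotone (cut N z)) (h' : Monotone (cut (N + 1) z)) :
    z (Fin.last m) = N + 1 := by
  have h1 := last_le_of_monotone h'
  by_contra h2
  refine h (monotone_cut fun c hc => ?_)
  rcases hc.lt_or_eq with hc | rfl
  · rw [cut_congr (N' := N + 1) hc.le, cut_congr (N' := N + 1) hc]
    exact h' (Nat.le_succ c)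
  · rw [cut_succ_of_le le_rfl, cut_last]
    omega

theorem extendLabel_of_monotone (h : Monotone (cut N z)) : extendLabel N ℓ z = ℓ z := if_pos h

theorem not_monotone_of_last (h : z (Fin.last m) = N + 1) : ¬ Monotone (cut N z) := by
  intro h'
  have := last_le_of_monotone h'
  omega

theorem extendLabel_of_last (h : z (Fin.last m) = N + 1) (h' : Monotone (cut (N + 1) z)) :
    extendLabel N ℓ z = sInf {c | 0 < cut (N + 1) z (c + 1)} := by
  rw [extendLabel, if_neg (not_monotone_of_last h), if_pos h']

theorem extendLabel_of_not_monotone (h : ¬ Monotone (cut (N + 1) z)) :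
    extendLabel N ℓ z = m + 2 := by
  rw [extendLabel, if_neg fun h' => h (monotone_cut_of_le h' (by omega)), if_neg h]

theorem sInf_gap (hN : 0 ≤ N) (h : z (Fin.last m) = N + 1) :
    sInf {c | 0 < cut (N + 1) z (c + 1)} ≤ m ∧
      cut (N + 1) z (sInf {c | 0 < cut (N + 1) z (c + 1)}) <
        cut (N + 1) z (sInf {c | 0 < cut (N + 1) z (c + 1)} + 1) := by
  have hm : m ∈ {c | 0 < cut (N + 1) z (c + 1)} := by
    change 0 < cut (N + 1) z (m + 1)
    rw [cut_last]
    omega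
  have h1 : 0 < cut (N + 1) z (_ + 1) := Nat.sInf_mem ⟨m, hm⟩
  refine ⟨Nat.sInf_le hm, lt_of_le_of_lt ?_ h1⟩
  generalize hc : sInf {c | 0 < cut (N + 1) z (c + 1)} = c
  cases c with
  | zero => rfl
  | succ c =>
    have := Nat.notMem_of_lt_sInf (s := {c | 0 < cut (N + 1) z (c + 1)}) (m := c) (by omega)
    simpa using this

theorem monotone_of_extendLabel_eq (hN : 0 ≤ N) (h : extendLabel N ℓ z = m + 1) :
    Monotone (cut N z) := by
  by_contra h1
  by_cases h2 : Monotone (cut (N + 1) z)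
  · have h3 := last_eq_of_not_monotone h1 h2
    rw [extendLabel_of_last h3 h2] at h
    have := (sInf_gap hN h3).1
    omega
  · rw [extendLabel_of_not_monotone h2] at h
    omega

theorem extendLabel_gap (hN : 0 ≤ N) (hℓ : ∀ z, Monotone (cut N z) →
      ℓ z ≤ m + 1 ∧ cut N z (ℓ z) < cut N z (ℓ z + 1))
    (h : extendLabel N ℓ z < m + 1) : Monotone (cut (N + 1) z) ∧
    cut (N + 1) z (extendLabel N ℓ z) < cut (N + 1) z (extendLabel N ℓ z + 1) := by
  by_cases h1 : Monotone (cut N z)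
  · refine ⟨monotone_cut_of_le h1 (by omega), ?_⟩
    rw [extendLabel_of_monotone h1] at h ⊢
    rw [cut_congr (N' := N) h.le, cut_congr (N' := N) h]
    exact (hℓ z h1).2
  · by_cases h2 : Monotone (cut (N + 1) z)
    · have h3 := last_eq_of_not_monotone h1 h2
      rw [extendLabel_of_last h3 h2]
      exact ⟨h2, (sInf_gap hN h3).2⟩
    · rw [extendLabel_of_not_monotone h2] at h
      omega

end Label

theorem eq_sub_of_strictAnti {m : ℕ} {f : ℕ → ℕ} (hlt : ∀ k < m, f k < m)
    (hanti : ∀ a b, a < b → b < m → f b < f a) {k : ℕ} (hk : k < m) : f k = m - 1 - k := by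
  have hle : ∀ k < m, f k ≤ m - 1 - k := by
    intro k
    induction k with
    | zero => intro hk; have := hlt 0 hk; omega
    | succ k ih =>
      intro hk
      have h1 := ih (by omega)
      have h2 := hanti k (k + 1) (by omega) hk
      omega
  have hge : ∀ i < m, i ≤ f (m - 1 - i) := by
    intro i
    induction i with
    | zero => intro _; omega
    | succ i ih =>
      intro hi
      have h1 := ih (by omega)
      have h2 := hanti (m - 1 - (i + 1)) (m - 1 - i) (by omega) (by omega)
      omega
  have h1 := hle k hk
  have h2 := hge (m - 1 - k) (by omega)
  rw [show m - 1 - (m - 1 - k) = k by omega] at h2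
  omega

/-- The unique door on the outer boundary. -/
def outerDoor (m : ℕ) (N : ℤ) : (Fin (m + 1) → ℤ) × Equiv.Perm (Fin (m + 1)) × ℕ :=
  (fun k => if (k : ℕ) = m then N + 1 else 0, Fin.revPerm.trans (finRotate (m + 1)).symm, m + 1)

theorem coe_outerDoor_perm {m : ℕ} {N : ℤ} (k : Fin (m + 1)) :
    ((outerDoor m N).2.1 k : ℕ) = if (k : ℕ) = m then m else m - 1 - k := by
  have := k.2
  simp only [outerDoor, Equiv.trans_apply, coe_finRotate_symm_eq, Fin.revPerm_apply, Fin.val_rev]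
  split_ifs <;> omega

section Sperner

variable {m : ℕ} {N : ℤ} {ℓ : (Fin (m + 1) → ℤ) → ℕ} {z : Fin (m + 1) → ℤ}
  {ρ : Equiv.Perm (Fin (m + 1))} {i : ℕ}

theorem extendLabel_le (hN : 0 ≤ N) (hℓ : ∀ z, Monotone (cut N z) →
      ℓ z ≤ m + 1 ∧ cut N z (ℓ z) < cut N z (ℓ z + 1))
    (h : Monotone (cut (N + 1) z)) : extendLabel N ℓ z ≤ m + 1 := by
  by_cases h1 : Monotone (cut N z)
  · rw [extendLabel_of_monotone h1]
    exact (hℓ z h1).1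
  · have h2 := last_eq_of_not_monotone h1 h
    rw [extendLabel_of_last h2 h]
    exact (sInf_gap hN h2).1.trans (Nat.le_succ m)

theorem outerDoor_isDoor (hN : 0 ≤ N) : IsDoor (extendLabel N ℓ) (outerDoor m N) ∧
    extendLabel N ℓ (kuhnVertex (outerDoor m N).1 (outerDoor m N).2.1 (m + 1)) = m + 2 := by
  refine ⟨⟨le_rfl, fun c hc => ⟨m - c, by omega, by simp [outerDoor]; omega, ?_⟩⟩, ?_⟩
  · set v := kuhnVertex (outerDoor m N).1 (outerDoor m N).2.1 (m - c) with hv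
    have hval : ∀ k, v k = if (k : ℕ) = m then N + 1 else if c ≤ k then 1 else 0 := by
      intro k
      have := k.2
      simp only [hv, kuhnVertex, coe_outerDoor_perm]
      simp only [outerDoor]
      split_ifs <;> omega
    have hlast : v (Fin.last m) = N + 1 := by simp [hval]
    have hcut : ∀ k < m + 1, cut (N + 1) v (k + 1) =
        if k = m then N + 1 else if c ≤ k then 1 else 0 :=
      fun k hk => (cut_succ ⟨k, hk⟩).trans (hval _)
    have hmono : Monotone (cut (N + 1) v) := by
      refine monotone_cut fun k hk => ?_
      rcases hk.lt_or_eq with hk | rfl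
      · rw [hcut k hk]
        cases k with
        | zero => rw [cut_zero]; split_ifs <;> omega
        | succ k => rw [hcut k (by omega)]; split_ifs <;> omega
      · rw [cut_succ_of_le le_rfl, cut_last, hlast]
    rw [extendLabel_of_last hlast hmono]
    apply le_antisymm
    · apply Nat.sInf_le
      change 0 < cut (N + 1) v (c + 1)
      rw [hcut c hc]
      split_ifs <;> omega
    · by_contra! hlt
      have h1 : 0 < cut (N + 1) v (_ + 1) := Nat.sInf_mem (s := {c | 0 < cut (N + 1) v (c + 1)})
        ⟨m, by change 0 < cut (N + 1) v (m + 1); rw [cut_last]; omega⟩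
      rw [hcut _ (by omega)] at h1
      split_ifs at h1 <;> omega
  · refine extendLabel_of_not_monotone fun h => ?_
    have := last_le_of_monotone h
    simp [kuhnVertex, outerDoor] at this

theorem eq_outerDoor (hN : 0 ≤ N) (hℓ : ∀ z, Monotone (cut N z) →
      ℓ z ≤ m + 1 ∧ cut N z (ℓ z) < cut N z (ℓ z + 1))
    (h : IsDoor (extendLabel N ℓ) (z, ρ, i))
    (hi : ¬ Monotone (cut (N + 1) (kuhnVertex z ρ i))) : (z, ρ, i) = outerDoor m N := by
  have hmono : ∀ j ≤ m + 1, j ≠ i → Monotone (cut (N + 1) (kuhnVertex z ρ j)) :=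
    fun j hj hji => (extendLabel_gap hN hℓ (h.label_lt hj hji)).1
  have hlast : N + 1 < kuhnVertex z ρ i (Fin.last m) := by
    by_contra! hle
    refine hi (monotone_cut fun c hc => ?_)
    rcases hc.lt_or_eq with hc | rfl
    · obtain ⟨j, -, -, hj⟩ := h.2 c hc
      have := (extendLabel_gap hN hℓ (hj.trans_lt hc)).2
      rw [hj] at this
      exact cut_kuhnVertex_le_succ this
    · rwa [cut_succ_of_le le_rfl, cut_last]
  have hi' : i = m + 1 := by
    by_contra hne
    have h1 := last_le_of_monotone (hmono (m + 1) le_rfl (Ne.symm hne))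
    have h2 := kuhnVertex_mono (z := z) (ρ := ρ) h.1 (Fin.last m)
    simp only at h2
    omega
  subst hi'
  have hm := last_le_of_monotone (hmono m (by omega) (by omega))
  have hρm : (ρ (Fin.last m) : ℕ) = m := by
    have := (ρ (Fin.last m)).2
    simp only [kuhnVertex] at hlast hm
    split_ifs at hlast hm <;> omega
  have hzm : z (Fin.last m) = N + 1 := by
    simp only [kuhnVertex, hρm] at hlast hm
    split_ifs at hlast hm <;> omega
  have hvm : ∀ j ≤ m, kuhnVertex z ρ j (Fin.last m) = N + 1 := by
    intro j hj
    simp only [kuhnVertex, hρm]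
    rw [if_neg (by omega), hzm, add_zero]
  have hcut : ∀ j (k : Fin (m + 1)), cut (N + 1) (kuhnVertex z ρ j) (k + 1) =
      z k + if (ρ k : ℕ) < j then 1 else 0 := fun j k => cut_succ k
  -- the label of a vertex is its first coordinate that is positive
  have hlabel : ∀ c ≤ m, ∃ j ≤ m, (∀ k : Fin (m + 1), (k : ℕ) < c → kuhnVertex z ρ j k ≤ 0) ∧
      0 < cut (N + 1) (kuhnVertex z ρ j) (c + 1) := by
    intro c hc
    obtain ⟨j, hj, hji, hjc⟩ := h.2 c (Nat.lt_succ_of_le hc)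
    simp only at hj hji hjc
    have hj' : j ≤ m := by omega
    rw [extendLabel_of_last (hvm j hj') (hmono j hj hji)] at hjc
    refine ⟨j, hj', fun k hk => ?_, ?_⟩
    · have := Nat.notMem_of_lt_sInf (hk.trans_eq hjc.symm)
      rw [← cut_succ (N := N + 1) (z := kuhnVertex z ρ j) k]
      simpa using this
    · rw [← hjc]
      exact Nat.sInf_mem (s := {c | 0 < cut (N + 1) (kuhnVertex z ρ j) (c + 1)})
        ⟨m, by change 0 < cut (N + 1) _ (m + 1); rw [cut_last, hvm j hj']; omega⟩
  have hz0 : ∀ k : Fin (m + 1), (k : ℕ) < m → z k = 0 := by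
    intro k hk
    obtain ⟨j, hj, hle, -⟩ := hlabel m le_rfl
    have h1 := hle k hk
    have h2 := hmono 0 (by omega) (by omega) (Nat.zero_le (k + 1))
    rw [cut_zero, hcut, if_neg (by omega)] at h2
    simp only [kuhnVertex] at h1
    split_ifs at h1 <;> omega
  have hanti : ∀ a b : Fin (m + 1), a < b → (b : ℕ) < m → ρ b < ρ a := by
    intro a b hab hb
    obtain ⟨j, hj, hle, hpos⟩ := hlabel b hb.le
    have h1 := hle a hab
    rw [hcut, hz0 b hb] at hpos
    simp only [kuhnVertex, hz0 a (by omega)] at h1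
    rw [Fin.lt_def]
    split_ifs at h1 hpos <;> omega
  have hρlt : ∀ k : Fin (m + 1), (k : ℕ) < m → (ρ k : ℕ) < m := by
    intro k hk
    have h1 : ρ k ≠ ρ (Fin.last m) := fun h => by
      have := ρ.injective h
      simp [this] at hk
    have h2 := (ρ k).2
    have h3 := fun h => h1 (Fin.ext h)
    omega
  have hρ : ∀ k : Fin (m + 1), (k : ℕ) < m → (ρ k : ℕ) = m - 1 - k := by
    intro k hk
    have := eq_sub_of_strictAnti (m := m)
      (f := fun k => if hk : k < m + 1 then (ρ ⟨k, hk⟩ : ℕ) else 0) (fun k hk => ?_)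
      (fun a b hab hb => ?_) hk
    · simpa only [dif_pos k.2] using this
    · simpa [Nat.lt_succ_of_lt hk] using hρlt ⟨k, Nat.lt_succ_of_lt hk⟩ hk
    · have ha : a < m + 1 := by omega
      simpa [Nat.lt_succ_of_lt hb, ha] using
        hanti ⟨a, by omega⟩ ⟨b, Nat.lt_succ_of_lt hb⟩ hab hb
  refine Prod.ext (funext fun k => ?_) (Prod.ext (Equiv.ext fun k => Fin.ext ?_) rfl)
  · simp only [outerDoor]
    split_ifs with hk
    · rw [← hzm, show k = Fin.last m from Fin.ext hk]
    · exact hz0 k (by omega)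
  · rw [coe_outerDoor_perm]
    split_ifs with hk
    · simpa only [show k = Fin.last m from Fin.ext hk] using hρm
    · exact hρ k (by omega)

/-- **Sperner's lemma** for the Kuhn triangulation of the sequences `0 ≤ z 0 ≤ … ≤ z m ≤ N`. -/
theorem exists_rainbow_simplex (hN : 0 ≤ N) (hℓ : ∀ z, Monotone (cut N z) →
      ℓ z ≤ m + 1 ∧ cut N z (ℓ z) < cut N z (ℓ z + 1)) :
    ∃ (z : Fin (m + 1) → ℤ) (ρ : Equiv.Perm (Fin (m + 1))), ∀ c ≤ m + 1, ∃ j ≤ m + 1,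
      Monotone (cut N (kuhnVertex z ρ j)) ∧ ℓ (kuhnVertex z ρ j) = c := by
  obtain ⟨T, hT, hmem⟩ := exists_even_doors (L := extendLabel N ℓ) (B := N + 1) (by
    intro z hz k
    have h := (extendLabel_gap hN hℓ hz).1
    rw [← cut_succ (N := N + 1) (z := z) k]
    refine ⟨h (Nat.zero_le (k + 1)), (h (show (k : ℕ) + 1 ≤ m + 2 by omega)).trans_eq ?_⟩
    exact cut_succ_of_le le_rfl)
  by_contra hno
  have hsingle : T = {outerDoor m N} := by
    refine Finset.eq_singleton_iff_unique_mem.2 ⟨?_, ?_⟩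
    · have := outerDoor_isDoor (ℓ := ℓ) hN
      exact (hmem _ _ _).2 ⟨this.1, (Nat.le_succ _).trans this.2.ge⟩
    · rintro ⟨z, ρ, i⟩ hs
      obtain ⟨hdoor, hge⟩ := (hmem z ρ i).1 hs
      refine eq_outerDoor hN hℓ hdoor fun hi => hno ⟨z, ρ, fun c hc => ?_⟩
      have heq := le_antisymm (extendLabel_le hN hℓ hi) hge
      have hiN := monotone_of_extendLabel_eq hN heq
      rw [extendLabel_of_monotone hiN] at heq
      rcases hc.lt_or_eq with hc | rfl
      · obtain ⟨j, hj, hji, hjc⟩ := hdoor.2 c hc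
        simp only at hj hji hjc
        have hjN : Monotone (cut N (kuhnVertex z ρ j)) := by
          by_contra hjN
          have h1 := last_eq_of_not_monotone hjN
            (extendLabel_gap hN hℓ (hdoor.label_lt hj hji)).1
          have h2 := kuhnVertex_le_add_one (z := z) (ρ := ρ) j i (Fin.last m)
          have h3 := (hℓ _ hiN).2
          rw [heq, cut_succ_of_le le_rfl, cut_last] at h3
          omega
        exact ⟨j, hj, hjN, by rw [← hjc, extendLabel_of_monotone hjN]⟩
      · exact ⟨i, hdoor.1, hiN, heq⟩
  rw [hsingle, Finset.card_singleton] at hT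
  exact absurd hT (by decide)

end Sperner

section Rounding

theorem dvd_add_one_of_ediv_ne {M x : ℤ} (hM : 0 < M) (h : x / M ≠ (x + 1) / M) : M ∣ x + 1 := by
  by_contra hd
  have h1 : 0 < (x + 1) % M :=
    lt_of_le_of_ne (Int.emod_nonneg _ hM.ne') fun h => hd (Int.dvd_of_emod_eq_zero h.symm)
  have h2 := Int.emod_lt_of_pos (x + 1) hM
  have h3 := Int.emod_add_mul_ediv (x + 1) M
  refine h ((Int.ediv_emod_unique hM (r := (x + 1) % M - 1)).2 ⟨?_, ?_, ?_⟩).1 <;> omega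

theorem card_ediv_ne_le_one {M : ℕ} {a a' : ℤ} (h1 : a ≤ a') (h2 : a' ≤ a + 1) :
    ((Finset.range M).filter fun j : ℕ => (a + j) / M ≠ (a' + j) / M).card ≤ 1 := by
  rw [Finset.card_le_one]
  intro i hi j hj
  rw [Finset.mem_filter, Finset.mem_range] at hi hj
  obtain rfl | rfl : a' = a ∨ a' = a + 1 := by omega
  · exact absurd rfl hi.2
  have hM : (0 : ℤ) < M := by omega
  have hi' := dvd_add_one_of_ediv_ne hM (x := a + i) (by rw [add_right_comm]; exact hi.2)
  have hj' := dvd_add_one_of_ediv_ne hM (x := a + j) (by rw [add_right_comm]; exact hj.2)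
  have h := dvd_sub hi' hj'
  have := Int.eq_zero_of_abs_lt_dvd h (by rw [abs_lt]; constructor <;> omega)
  omega

/-- Divide the coordinates of `z`, shifted by `j`, by `M`. -/
def roundShift {d : ℕ} (M : ℕ) (z : Fin d → ℤ) (j : ℕ) : Fin d → ℤ := fun k => (z k + j) / M

variable {d M : ℕ} {n : ℤ} {z z' : Fin d → ℤ} {j j' c : ℕ}

theorem cut_roundShift (hj : j < M) :
    cut n (roundShift M z j) c = (cut (n * M) z c + j) / M := by
  have hM : (M : ℤ) ≠ 0 := by omega
  have hj0 : (j : ℤ) / M = 0 := Int.ediv_eq_zero_of_lt (by omega) (by omega)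
  cases c with
  | zero => simp [hj0]
  | succ c =>
    simp only [cut, roundShift]
    split_ifs
    · rfl
    · rw [add_comm, Int.add_mul_ediv_right _ _ hM, hj0, zero_add]

theorem monotone_cut_roundShift (hj : j < M) (hz : Monotone (cut (n * M) z)) :
    Monotone (cut n (roundShift M z j)) := by
  intro a b hab
  rw [cut_roundShift hj, cut_roundShift hj]
  exact Int.ediv_le_ediv (by omega) (by linarith [hz hab])

theorem roundShift_mono (hM : 0 < M) (h : j ≤ j') (k : Fin d) :
    roundShift M z j k ≤ roundShift M z j' k :=
  Int.ediv_le_ediv (by omega) (by omega)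

theorem roundShift_le_add_one (hM : 0 < M) (h : j' ≤ j + M) (k : Fin d) :
    roundShift M z j' k ≤ roundShift M z j k + 1 := by
  have hM' : (M : ℤ) ≠ 0 := by omega
  simp only [roundShift]
  rw [← Int.add_mul_ediv_right _ _ hM']
  exact Int.ediv_le_ediv (by omega) (by omega)

/-- The number of shifts `j < M` for which `c` belongs to the set assigned to the rounded point. -/
def shiftCount (M : ℕ) (S : (Fin d → ℤ) → Finset ℕ) (z : Fin d → ℤ) (c : ℕ) : ℕ :=
  ((Finset.range M).filter fun j => c ∈ S (roundShift M z j)).card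

variable {S : (Fin d → ℤ) → Finset ℕ}

theorem shiftCount_le_add (h : ∀ k, z k ≤ z' k ∧ z' k ≤ z k + 1 ∨ z' k ≤ z k ∧ z k ≤ z' k + 1) :
    shiftCount M S z c ≤ shiftCount M S z' c + d := by
  set bad : Fin d → Finset ℕ := fun k =>
    (Finset.range M).filter fun j => roundShift M z j k ≠ roundShift M z' j k with hbad
  have hcard : ∀ k, (bad k).card ≤ 1 := by
    intro k
    rcases h k with ⟨h1, h2⟩ | ⟨h1, h2⟩
    · exact card_ediv_ne_le_one h1 h2
    · simp only [hbad, ne_comm (a := roundShift M z _ k)]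
      exact card_ediv_ne_le_one h1 h2
  have hsub : ((Finset.range M).filter fun j => c ∈ S (roundShift M z j)) ⊆
      ((Finset.range M).filter fun j => c ∈ S (roundShift M z' j)) ∪ Finset.univ.biUnion bad := by
    intro j hj
    rw [Finset.mem_filter] at hj
    by_cases heq : roundShift M z j = roundShift M z' j
    · exact Finset.mem_union_left _ (Finset.mem_filter.2 ⟨hj.1, heq ▸ hj.2⟩)
    · obtain ⟨k, hk⟩ := Function.ne_iff.1 heq
      exact Finset.mem_union_right _ (Finset.mem_biUnion.2
        ⟨k, Finset.mem_univ k, Finset.mem_filter.2 ⟨hj.1, hk⟩⟩)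
  calc shiftCount M S z c ≤ _ := Finset.card_le_card hsub
    _ ≤ shiftCount M S z' c + (Finset.univ.biUnion bad).card := Finset.card_union_le _ _
    _ ≤ shiftCount M S z' c + d := by
      have := Finset.card_biUnion_le_card_mul Finset.univ bad 1 fun k _ => hcard k
      simp only [Finset.card_univ, Fintype.card_fin, mul_one] at this
      omega

theorem sum_shiftCount (s : Finset ℕ) : ∑ c ∈ s, shiftCount M S z c =
    ∑ j ∈ Finset.range M, (s.filter fun c => c ∈ S (roundShift M z j)).card := by
  simp only [shiftCount, Finset.card_filter]
  exact Finset.sum_comm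

end Rounding

/-- If few nonempty gaps are selected for every cut of an integer interval, then there are two
neighbouring cuts with disjoint selections. -/
theorem exists_disjoint_neighbours {m q : ℕ} {n : ℤ} (hn : 0 ≤ n) (hq : q * q < m + 2)
    (S : (Fin (m + 1) → ℤ) → Finset ℕ)
    (hne : ∀ y, Monotone (cut n y) → (S y).Nonempty)
    (hcard : ∀ y, Monotone (cut n y) → (S y).card ≤ q)
    (hgap : ∀ y, Monotone (cut n y) → ∀ c ∈ S y, c ≤ m + 1 ∧ cut n y c < cut n y (c + 1)) :
    ∃ y y', Monotone (cut n y) ∧ Monotone (cut n y') ∧ (∀ k, y k ≤ y' k) ∧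
      (∀ k, y' k ≤ y k + 1) ∧ Disjoint (S y) (S y') := by
  by_contra hno
  obtain ⟨M, hMdef⟩ : ∃ M, M = (m + 2) * (m + 1) * q + 1 := ⟨_, rfl⟩
  have hM : 0 < M := by omega
  have hchoose : ∀ z, ∃ c, Monotone (cut (n * M) z) →
      (c ≤ m + 1 ∧ cut (n * M) z c < cut (n * M) z (c + 1)) ∧ M ≤ q * shiftCount M S z c := by
    intro z
    by_cases hz : Monotone (cut (n * M) z)
    swap
    · exact ⟨0, fun h => absurd h hz⟩
    have hmono : ∀ j < M, Monotone (cut n (roundShift M z j)) :=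
      fun j hj => monotone_cut_roundShift hj hz
    have hlarge : ∃ c ∈ S (roundShift M z 0), M ≤ q * shiftCount M S z c := by
      by_contra! hlt
      have h1 : M ≤ ∑ c ∈ S (roundShift M z 0), shiftCount M S z c := by
        rw [sum_shiftCount]
        calc M = ∑ j ∈ Finset.range M, 1 := by simp
          _ ≤ _ := Finset.sum_le_sum fun j hj => ?_
        rw [Finset.mem_range] at hj
        refine Finset.card_pos.2 ?_
        by_contra hempty
        refine hno ⟨_, _, hmono 0 hM, hmono j hj, roundShift_mono hM (Nat.zero_le j),
          roundShift_le_add_one hM (by omega), ?_⟩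
        rw [Finset.disjoint_left]
        exact fun c hc hc' => hempty ⟨c, Finset.mem_filter.2 ⟨hc, hc'⟩⟩
      have h2 := Finset.sum_lt_sum_of_nonempty (hne _ (hmono 0 hM)) hlt
      rw [← Finset.mul_sum, Finset.sum_const, smul_eq_mul] at h2
      have h3 := Nat.mul_le_mul_right M (hcard _ (hmono 0 hM))
      have h4 := Nat.mul_le_mul_left q h1
      omega
    obtain ⟨c, hc, hcM⟩ := hlarge
    have hc' := hgap _ (hmono 0 hM) c hc
    refine ⟨c, fun _ => ⟨⟨hc'.1, ?_⟩, hcM⟩⟩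
    rw [cut_roundShift hM, cut_roundShift hM] at hc'
    by_contra! hle
    exact hc'.2.not_ge (Int.ediv_le_ediv (by omega) (by omega))
  choose ℓ hℓ using hchoose
  obtain ⟨z, ρ, hsimplex⟩ := exists_rainbow_simplex (m := m) (N := n * M) (ℓ := ℓ)
    (by positivity) fun z hz => (hℓ z hz).1
  obtain ⟨i, -, hi, -⟩ := hsimplex 0 (Nat.zero_le _)
  set v := kuhnVertex z ρ i
  have hlower : ∀ c ∈ Finset.range (m + 2), M ≤ q * (shiftCount M S v c + (m + 1)) := by
    intro c hc
    obtain ⟨j, -, hj, hjc⟩ := hsimplex c (by rw [Finset.mem_range] at hc; omega)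
    have h1 := (hℓ _ hj).2
    rw [hjc] at h1
    refine h1.trans (Nat.mul_le_mul_left q (shiftCount_le_add fun k => ?_))
    rcases le_total i j with hij | hij
    · exact Or.inr ⟨kuhnVertex_mono hij k, kuhnVertex_le_add_one j i k⟩
    · exact Or.inl ⟨kuhnVertex_mono hij k, kuhnVertex_le_add_one i j k⟩
  have hupper : ∑ c ∈ Finset.range (m + 2), shiftCount M S v c ≤ M * q := by
    rw [sum_shiftCount]
    calc _ ≤ ∑ _j ∈ Finset.range M, q := Finset.sum_le_sum fun j hj => ?_
      _ = M * q := by simp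
    refine (Finset.card_le_card fun c hc => (Finset.mem_filter.1 hc).2).trans (hcard _ ?_)
    exact monotone_cut_roundShift (Finset.mem_range.1 hj) hi
  have hsum := Finset.sum_le_sum hlower
  rw [← Finset.mul_sum, Finset.sum_add_distrib, Finset.sum_const, Finset.sum_const,
    Finset.card_range, smul_eq_mul, smul_eq_mul] at hsum
  have h1 := Nat.mul_le_mul_left q hupper
  have h2 := Nat.mul_le_mul_right M (Nat.succ_le_of_lt hq)
  nlinarith
/-- The index of the gap of the cut `y` that contains the integer `x`. -/
noncomputable def gapIndex {d : ℕ} (n : ℤ) (y : Fin d → ℤ) (x : ℤ) : ℕ :=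
  sInf {c | x < cut n y (c + 1)}

section GapIndex

variable {d : ℕ} {n x : ℤ} {y y' : Fin d → ℤ}

theorem gapIndex_le (hx : x < n) : gapIndex n y x ≤ d :=
  Nat.sInf_le (by change x < cut n y (d + 1); rwa [cut_succ_of_le le_rfl])

theorem lt_cut_gapIndex_succ (hx : x < n) : x < cut n y (gapIndex n y x + 1) :=
  Nat.sInf_mem (s := {c | x < cut n y (c + 1)})
    ⟨d, by change x < cut n y (d + 1); rwa [cut_succ_of_le le_rfl]⟩

theorem cut_gapIndex_le (hx : 0 ≤ x) : cut n y (gapIndex n y x) ≤ x := by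
  generalize hc : gapIndex n y x = c
  cases c with
  | zero => exact hx
  | succ c =>
    have := Nat.notMem_of_lt_sInf (s := {c | x < cut n y (c + 1)}) (m := c)
      (by unfold gapIndex at hc; omega)
    exact not_lt.1 this

/-- An integer that changes its gap between two neighbouring cuts is the left end of its gap. -/
theorem eq_cut_gapIndex (hx : 0 ≤ x) (hxn : x < n) (hy' : Monotone (cut n y'))
    (h1 : ∀ k, y k ≤ y' k) (h2 : ∀ k, y' k ≤ y k + 1) (hne : gapIndex n y x ≠ gapIndex n y' x) :
    x = cut n y (gapIndex n y x) := by
  have hle : gapIndex n y' x ≤ gapIndex n y x :=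
    Nat.sInf_le ((lt_cut_gapIndex_succ hxn).trans_le (cut_le_cut h1))
  have h3 := hy' (Nat.succ_le_of_lt (lt_of_le_of_ne hle hne.symm))
  have h4 := lt_cut_gapIndex_succ (y := y') hxn
  have h5 := cut_le_cut_add_one (N := n) (c := gapIndex n y x) h2
  have h6 := cut_gapIndex_le (n := n) (y := y) hx
  rw [Nat.succ_eq_add_one] at h3
  omega

end GapIndex

/-- A `t`-intersecting hypergraph has a colouring with `b > q ^ 2` colours, where `q < t`, in which
every hyperedge receives more than `q` colours. -/
theorem IsIntersecting.exists_coloring {V : Type*} [Fintype V] [DecidableEq V] {t q m : ℕ}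
    {G : Finset (Finset V)} (hG : IsIntersecting t G) (hqt : q < t) (hq : q * q < m + 2) :
    ∃ h : V → Fin (m + 2), ∀ e ∈ G, q < (e.image h).card := by
  by_contra! hno
  set n : ℤ := (Fintype.card V : ℤ) with hn
  set pos : V → ℤ := fun v => ((Fintype.equivFin V v : ℕ) : ℤ) with hpos
  have hpos0 : ∀ v, 0 ≤ pos v := fun v => Int.natCast_nonneg _
  have hposn : ∀ v, pos v < n := fun v => by
    have := (Fintype.equivFin V v).2
    simp only [hpos, hn]
    exact_mod_cast this
  have hposinj : Function.Injective pos := fun v w h =>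
    (Fintype.equivFin V).injective (Fin.ext (Int.ofNat.inj h))
  have hbad : ∀ y : Fin (m + 1) → ℤ,
      ∃ e ∈ G, (e.image fun v => gapIndex n y (pos v)).card ≤ q := by
    intro y
    obtain ⟨e, he, hcard⟩ := hno fun v =>
      ⟨gapIndex n y (pos v), Nat.lt_succ_of_le (gapIndex_le (hposn v))⟩
    refine ⟨e, he, le_trans (Eq.le ?_) hcard⟩
    rw [← Finset.card_image_of_injective _ Fin.val_injective, Finset.image_image]
    rfl
  choose e he hcard using hbad
  have hcap : ∀ y y', t ≤ (e y ∩ e y').card := fun y y' => hG _ (he y) _ (he y')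
  obtain ⟨y, y', -, hy', h1, h2, hdisj⟩ := exists_disjoint_neighbours (n := n)
    (Int.natCast_nonneg _) hq (fun y => (e y).image fun v => gapIndex n y (pos v))
    (fun y _ => by
      have := hcap y y
      rw [Finset.inter_self] at this
      exact (Finset.card_pos.1 (by omega)).image _)
    (fun y _ => hcard y)
    (fun y _ c hc => by
      obtain ⟨v, -, rfl⟩ := Finset.mem_image.1 hc
      exact ⟨gapIndex_le (hposn v),
        (cut_gapIndex_le (hpos0 v)).trans_lt (lt_cut_gapIndex_succ (hposn v))⟩)
  have heq : ∀ v ∈ e y ∩ e y', pos v = cut n y (gapIndex n y (pos v)) := by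
    intro v hv
    rw [Finset.mem_inter] at hv
    exact eq_cut_gapIndex (hpos0 v) (hposn v) hy' h1 h2
      (Finset.disjoint_iff_ne.1 hdisj _ (Finset.mem_image_of_mem _ hv.1) _
        (Finset.mem_image_of_mem _ hv.2))
  have hle : (e y ∩ e y').card ≤ ((e y).image fun v => gapIndex n y (pos v)).card := by
    refine Finset.card_le_card_of_injOn (fun v => gapIndex n y (pos v))
      (fun v hv => Finset.mem_image_of_mem _ (Finset.mem_inter.1 hv).1) fun v hv w hw hvw => ?_
    apply hposinj
    rw [heq v hv, heq w hw]
    exact congrArg _ hvw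
  have := hcap y y'
  have := hcard y
  omega

/-- Theorem 1 (general form): if `t ≥ p ≥ 2`, `b ≥ p`, `b > (p-1)(t+1)`, `x ≥ 1` and
`C(b, p-1)·((p-1)/b)^(t·x) < 1`, then every `t`-intersecting hypergraph admits `x` hash
functions into `[b]` such that every hyperedge gets at least `p` values under one of them;
i.e. `λ(t,p,b) ≤ x`. -/
theorem partially_perfect_upper_bound
    (t p b x : ℕ) (htp : t ≥ p) (hp : p ≥ 2) (hbp : b ≥ p)
    (hb : b > (p - 1) * (t + 1)) (hx : x ≥ 1)
    (hprob : (b.choose (p - 1) : ℝ) * (((p - 1 : ℕ) : ℝ) / (b : ℝ)) ^ (t * x) < 1)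
    (V : Type*) [Fintype V] [DecidableEq V]
    (G : Finset (Finset V)) (hG : IsIntersecting t G) :
    ∃ h : Fin x → V → Fin b, ∀ e ∈ G, ∃ i : Fin x, p ≤ (e.image (h i)).card := by
  obtain ⟨m, rfl⟩ : ∃ m, b = m + 2 := ⟨b - 2, by omega⟩
  have hq := Nat.mul_le_mul_left (p - 1) (show p - 1 ≤ t + 1 by omega)
  obtain ⟨h, hh⟩ := hG.exists_coloring (show p - 1 < t by omega) (hq.trans_lt hb)
  refine ⟨fun _ => h, fun e he => ⟨⟨0, hx⟩, ?_⟩⟩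
  have := hh e he
  simp only
  omega
end

section
/- Let t, p, b be integers with t ≥ p ≥ 2 and b > (p-1)(t+1). Then for every t-intersecting hypergraph G on a finite vertex set V there exist two functions h_1, h_2 : V → [b] such that every hyperedge e of G satisfies |h_1(e)| ≥ p or |h_2(e)| ≥ p; equivalently, λ(t,p,b) ≤ 2. -/
theorem self_pow_le_factorial_sq (n : ℕ) : n ^ n ≤ n.factorial ^ 2 := by
  have h : n.factorial ^ 2 = ∏ i ∈ Finset.range n, (i + 1) * (n - i) := by
    rw [Finset.prod_mul_distrib, Finset.prod_range_add_one_eq_factorial, sq]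
    congr 1
    rw [← Finset.prod_range_add_one_eq_factorial, ← Finset.prod_range_reflect]
    refine Finset.prod_congr rfl fun i hi => ?_
    have := Finset.mem_range.1 hi
    omega
  rw [h, ← Finset.card_range n, ← Finset.prod_const, Finset.card_range]
  refine Finset.prod_le_prod' fun i hi => ?_
  have := Finset.mem_range.1 hi
  obtain ⟨k, rfl⟩ : ∃ k, n = i + 1 + k := ⟨n - (i + 1), by omega⟩
  rw [show i + 1 + k - i = k + 1 by omega]
  nlinarith

theorem choose_sq_lt_pow (p : ℕ) (hp : 2 ≤ p) :
    (p ^ 2).choose (p - 1) ^ 2 < p ^ (3 * p) := by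
  obtain ⟨k, rfl⟩ : ∃ k, p = k + 1 := ⟨p - 1, by omega⟩
  rw [Nat.add_sub_cancel]
  have h1 : k.factorial * ((k + 1) ^ 2).choose k ≤ ((k + 1) ^ 2) ^ k := by
    rw [← Nat.descFactorial_eq_factorial_mul_choose]
    exact Nat.descFactorial_le_pow _ _
  have h2 := self_pow_le_factorial_sq (k + 1)
  rw [Nat.factorial_succ] at h2
  have h3 : (k + 1) ^ (k + 1) * ((k + 1) ^ 2).choose k ^ 2 ≤
      (k + 1) ^ (k + 1) * (k + 1) ^ (3 * k + 1) := by
    calc _ ≤ ((k + 1) * k.factorial) ^ 2 * ((k + 1) ^ 2).choose k ^ 2 :=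
          Nat.mul_le_mul_right _ h2
      _ = (k + 1) ^ 2 * (k.factorial * ((k + 1) ^ 2).choose k) ^ 2 := by ring
      _ ≤ (k + 1) ^ 2 * (((k + 1) ^ 2) ^ k) ^ 2 := by gcongr
      _ = _ := by rw [← pow_mul, ← pow_mul]; ring
  refine (Nat.le_of_mul_le_mul_left h3 (by positivity)).trans_lt ?_
  exact Nat.pow_lt_pow_right (by omega) (by omega)

open Finset in
theorem prod_weighted_mean_le {ι : Type*} [Fintype ι] [DecidableEq ι] [Nonempty ι]
    {p : ℕ} (hp : Fintype.card ι = p) {s M : ℝ} {a b : ι → ℝ}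
    (hs0 : 0 ≤ s) (hs : s * ((p : ℝ) + 1) ^ 2 ≤ 1) (ha : ∀ i, 0 ≤ a i) (hab : ∀ i, a i ≤ b i)
    (h1 : ∀ i, b i * ∏ j ∈ univ.erase i, a j ≤ M) (h2 : ∏ i, b i ≤ (p : ℝ) ^ 3 * M) :
    ∏ i, ((1 - s) * a i + s * b i) ≤ M := by
  have hp1 : (1 : ℝ) ≤ p := by
    rw [← hp]; exact_mod_cast Fintype.card_pos
  have hs1 : s < 1 := by nlinarith
  set D : ℝ := (p : ℝ) ^ 2 + 2 * p with hD
  have hD0 : 0 < D := by positivity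
  have hsD : s * D ≤ 1 - s := by nlinarith
  by_contra! hM
  set m : ι → ℝ := fun i => (1 - s) * a i + s * b i with hm
  have hb : ∀ i, 0 ≤ b i := fun i => (ha i).trans (hab i)
  have hm0 : ∀ i, 0 ≤ m i := fun i =>
    add_nonneg (mul_nonneg (by linarith) (ha i)) (mul_nonneg hs0 (hb i))
  have hM0 : 0 ≤ M := by
    obtain ⟨i⟩ := ‹Nonempty ι›
    exact (mul_nonneg (hb i) (prod_nonneg fun j _ => ha j)).trans (h1 i)
  have hprod : 0 < ∏ i, m i := hM0.trans_lt hM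
  have hmpos : ∀ i, 0 < m i := fun i =>
    (hm0 i).lt_of_ne fun h => hprod.ne' (prod_eq_zero (mem_univ i) h.symm)
  set z : ι → ℝ := fun i => b i / m i with hz
  set g : ι → ℝ := fun i => a i / m i with hg
  have hz1 : ∀ i, 1 ≤ z i := fun i => by
    rw [hz, one_le_div (hmpos i)]
    have := hab i
    simp only [hm]
    nlinarith
  have hgz : ∀ i, (1 - s) * g i + s * z i = 1 := fun i => by
    have := (hmpos i).ne'
    simp only [hg, hz]
    field_simp
    rfl
  have hgL : ∀ i, 1 - (z i - 1) / D ≤ g i := fun i => by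
    have h := hgz i
    have h' := hz1 i
    have : (1 - s) * (1 - g i) = s * (z i - 1) := by linarith
    have h3 : D * (1 - g i) ≤ z i - 1 := by
      by_contra! hc
      have h4 : (1 - s) * (D * (1 - g i)) = s * D * (z i - 1) := by
        calc _ = D * ((1 - s) * (1 - g i)) := by ring
          _ = _ := by rw [this]; ring
      nlinarith
    have : 1 - g i ≤ (z i - 1) / D := by rw [le_div_iff₀ hD0]; linarith
    linarith
  have hzprod : ∏ i, z i < (p : ℝ) ^ 3 := by
    rw [hz, prod_div_distrib, div_lt_iff₀ hprod]
    refine h2.trans_lt ?_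
    gcongr
  obtain ⟨i, -, hi⟩ := exists_max_image univ z univ_nonempty
  have hlt : z i * ∏ j ∈ univ.erase i, g j < 1 := by
    rw [hz, hg, prod_div_distrib, div_mul_div_comm, mul_prod_erase univ m (mem_univ i),
      div_lt_one hprod]
    exact (h1 i).trans_lt hM
  have hgnn : 0 ≤ ∏ j ∈ univ.erase i, g j := prod_nonneg fun j _ => div_nonneg (ha j) (hm0 j)
  have hzi := hz1 i
  have hze : z i * ∏ j ∈ univ.erase i, z j = ∏ j, z j := mul_prod_erase univ z (mem_univ i)
  rcases le_or_gt (p : ℝ) (z i) with hZ | hZ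
  · have key : ∀ j ∈ univ.erase i, 1 ≤ g j ^ 2 * z j := fun j hj => by
      have hzj := hz1 j
      have hle : z j ≤ ∏ j ∈ univ.erase i, z j := by
        rw [← mul_prod_erase _ z hj]
        exact le_mul_of_one_le_right (by linarith)
          (Finset.one_le_prod fun k _ => hz1 k)
      have hzp : z j ≤ (p : ℝ) ^ 2 := by
        by_contra! hc
        have : (p : ℝ) * (p : ℝ) ^ 2 ≤ z i * ∏ j ∈ univ.erase i, z j :=
          mul_le_mul hZ (hc.le.trans hle) (by positivity) (by linarith)
        nlinarith
      set y := Real.sqrt (z j) with hy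
      have hyz : y ^ 2 = z j := Real.sq_sqrt (by linarith)
      have hy1 : 1 ≤ y := Real.one_le_sqrt.2 hzj
      have hyp : y ≤ p := Real.sqrt_le_iff.2 ⟨by linarith, hzp⟩
      have hyg : 1 ≤ g j * y := by
        have hfac : 0 ≤ (y - 1) * (D - y * (y + 1)) :=
          mul_nonneg (by linarith) (by nlinarith)
        have : 1 ≤ (1 - (z j - 1) / D) * y := by
          rw [← hyz, one_sub_div hD0.ne', div_mul_eq_mul_div, one_le_div hD0]
          nlinarith
        exact this.trans (mul_le_mul_of_nonneg_right (hgL j) (by linarith))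
      rw [← hyz, ← mul_pow]
      exact one_le_pow₀ hyg
    have hall : 1 ≤ (∏ j ∈ univ.erase i, g j) ^ 2 * ∏ j ∈ univ.erase i, z j := by
      rw [← prod_pow, ← prod_mul_distrib]
      exact Finset.one_le_prod key
    have hsq : (z i * ∏ j ∈ univ.erase i, g j) ^ 2 ≤ 1 :=
      pow_le_one₀ (mul_nonneg (by linarith) hgnn) hlt.le
    have hz3 : (p : ℝ) ^ 3 ≤ z i ^ 3 := by gcongr
    have : z i ^ 3 ≤ ∏ j, z j := by
      calc z i ^ 3 ≤ z i ^ 3 * ((∏ j ∈ univ.erase i, g j) ^ 2 * ∏ j ∈ univ.erase i, z j) :=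
            le_mul_of_one_le_right (by positivity) hall
        _ = (z i * ∏ j ∈ univ.erase i, g j) ^ 2 * (z i * ∏ j ∈ univ.erase i, z j) := by ring
        _ ≤ 1 * (z i * ∏ j ∈ univ.erase i, z j) :=
            mul_le_mul_of_nonneg_right hsq
              (by rw [hze]; exact prod_nonneg fun j _ => by linarith [hz1 j])
        _ = _ := by rw [one_mul, hze]
    linarith
  · have hx : (z i - 1) / D ≤ 1 := by
      rw [div_le_one hD0]; nlinarith
    have hcard : ((univ.erase i).card : ℝ) = p - 1 := by
      rw [card_erase_of_mem (mem_univ i), card_univ, hp, Nat.cast_sub (by exact_mod_cast hp1)]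
      simp
    have hpow : (1 - (z i - 1) / D) ^ (univ.erase i).card ≤ ∏ j ∈ univ.erase i, g j := by
      rw [← prod_const]
      refine prod_le_prod (fun _ _ => by linarith) fun j _ => le_trans ?_ (hgL j)
      have := hi j (mem_univ j)
      gcongr
    have hbern := one_add_mul_le_pow (a := -((z i - 1) / D)) (by linarith) (univ.erase i).card
    rw [hcard] at hbern
    have hfin : 1 - (p - 1) * ((z i - 1) / D) ≤ ∏ j ∈ univ.erase i, g j := by
      refine le_trans ?_ hpow
      rw [sub_eq_add_neg (1 : ℝ) ((z i - 1) / D)]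
      linarith
    have h4 : 1 ≤ z i * (1 - (p - 1) * ((z i - 1) / D)) := by
      have : z i * (1 - (p - 1) * ((z i - 1) / D)) - 1 =
          (z i - 1) * (D - z i * (p - 1)) / D := by
        field_simp; ring
      have h5 : 0 ≤ (z i - 1) * (D - z i * (p - 1)) / D :=
        div_nonneg (mul_nonneg (by linarith) (by nlinarith)) hD0.le
      linarith
    have := mul_le_mul_of_nonneg_left hfin (by linarith : 0 ≤ z i)
    linarith

open Finset Classical in
/-- The measure of `{S ⊆ U | F S}` when each element of `U` is chosen independently with
probability `s`. -/
noncomputable def biasedMeasure {V : Type*} (s : ℝ) (U : Finset V) (F : Finset V → Prop) : ℝ :=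
  ∑ S ∈ U.powerset, if F S then s ^ #S * (1 - s) ^ (#U - #S) else 0

section biasedMeasure

open Finset

variable {V : Type*} {s : ℝ} {U : Finset V} {F F' : Finset V → Prop}

theorem biasedMeasure_nonneg (hs0 : 0 ≤ s) (hs1 : s ≤ 1) : 0 ≤ biasedMeasure s U F := by
  refine sum_nonneg fun S _ => ?_
  have : 0 ≤ 1 - s := sub_nonneg.2 hs1
  split_ifs <;> positivity

theorem biasedMeasure_mono (hs0 : 0 ≤ s) (hs1 : s ≤ 1) (h : ∀ S, F S → F' S) :
    biasedMeasure s U F ≤ biasedMeasure s U F' := by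
  refine sum_le_sum fun S _ => ?_
  have : 0 ≤ 1 - s := sub_nonneg.2 hs1
  by_cases hS : F S
  · rw [if_pos hS, if_pos (h S hS)]
  · rw [if_neg hS]
    split_ifs <;> positivity

theorem biasedMeasure_le_one (hs0 : 0 ≤ s) (hs1 : s ≤ 1) : biasedMeasure s U F ≤ 1 := by
  refine (biasedMeasure_mono hs0 hs1 (F' := fun _ => True) fun _ _ => trivial).trans_eq ?_
  simp [biasedMeasure, sum_pow_mul_eq_add_pow]

theorem biasedMeasure_insert [DecidableEq V] {x : V} (hx : x ∉ U) :
    biasedMeasure s (insert x U) F =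
      (1 - s) * biasedMeasure s U F + s * biasedMeasure s U (fun S => F (insert x S)) := by
  rw [biasedMeasure, sum_powerset_insert hx, biasedMeasure, biasedMeasure, mul_sum, mul_sum]
  congr 1 <;> refine sum_congr rfl fun S hS => ?_ <;> have hS := mem_powerset.1 hS <;>
    have hc := card_le_card hS
  · rw [card_insert_of_notMem hx, Nat.succ_sub hc, pow_succ]
    split_ifs <;> ring
  · rw [card_insert_of_notMem hx, card_insert_of_notMem fun h => hx (hS h), Nat.add_sub_add_right]
    split_ifs <;> ring

/-- If sets `f i` drawn from upward closed families `F i` always have at least `c` elements lying in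
two or more of them, then the product of the biased measures of the `F i` is at most `p ^ (-3 * c)`. -/
theorem pow_mul_prod_biasedMeasure_le_one [DecidableEq V] {p : ℕ} (hp : 2 ≤ p)
    (hs0 : 0 ≤ s) (hs : s * ((p : ℝ) + 1) ^ 2 ≤ 1) (U : Finset V) (c : ℕ)
    (F : Fin p → Finset V → Prop) (hF : ∀ i S T, S ⊆ T → F i S → F i T)
    (hc : ∀ f : Fin p → Finset V, (∀ i, f i ⊆ U) → (∀ i, F i (f i)) →
      c ≤ #{x ∈ U | ∃ i j, i ≠ j ∧ x ∈ f i ∧ x ∈ f j}) :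
    ((p : ℝ) ^ 3) ^ c * ∏ i, biasedMeasure s U (F i) ≤ 1 := by
  have hs1 : s ≤ 1 := hs.trans' <| le_mul_of_one_le_right hs0 <| one_le_pow₀ <| by simp
  have hp0 : (0 : ℝ) < p := by positivity
  have hle (U : Finset V) (F : Fin p → Finset V → Prop) :
      ∏ i, biasedMeasure s U (F i) ≤ 1 :=
    prod_le_one (fun _ _ => biasedMeasure_nonneg hs0 hs1) fun _ _ => biasedMeasure_le_one hs0 hs1
  induction U using Finset.induction generalizing c F with
  | empty =>
    by_cases h : ∀ i, F i ∅
    · obtain rfl : c = 0 := by simpa using hc (fun _ => ∅) (by simp) h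
      simpa using hle ∅ F
    · push Not at h
      obtain ⟨i, hi⟩ := h
      rw [prod_eq_zero (mem_univ i) (by simp [biasedMeasure, hi])]
      simp
  | insert x U hx ih =>
    obtain _ | c := c
    · simpa using hle (insert x U) F
    have : Nonempty (Fin p) := ⟨⟨0, by omega⟩⟩
    simp only [biasedMeasure_insert hx]
    rw [← le_div_iff₀' (by positivity)]
    refine prod_weighted_mean_le (Fintype.card_fin p) hs0 hs
      (fun i => biasedMeasure_nonneg hs0 hs1)
      (fun i => biasedMeasure_mono hs0 hs1 fun S => hF i _ _ (subset_insert x S)) (fun i => ?_) ?_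
    · rw [le_div_iff₀' (by positivity)]
      have := ih (c + 1) (fun j S => if j = i then F j (insert x S) else F j S)
        (fun j S T hST => by
          split_ifs
          · exact hF j _ _ (insert_subset_insert x hST)
          · exact hF j _ _ hST) (fun f hfU hf => by
          refine (hc (fun j => if j = i then insert x (f j) else f j) (fun j => ?_)
            fun j => ?_).trans (card_le_card fun y => ?_)
          · split_ifs
            · exact insert_subset_insert x (hfU j)
            · exact (hfU j).trans (subset_insert x U)
          · have := hf j
            split_ifs with h <;> simpa [h] using this
          · simp only [mem_filter]
            rintro ⟨hy, j, k, hjk, hj, hk⟩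
            have hyx : y ≠ x := by
              rintro rfl
              have h (l : Fin p) : y ∉ f l := fun h => hx (hfU l h)
              grind
            grind)
      rw [← mul_prod_erase univ _ (mem_univ i)] at this
      simp only [if_true] at this
      rwa [prod_congr (g := fun j => biasedMeasure s U (F j)) rfl fun j hj => by
        simp only [if_neg (ne_of_mem_erase hj)]] at this
    · rw [pow_succ' ((p : ℝ) ^ 3), mul_one_div, div_mul_cancel_left₀ (by positivity), ← one_div,
        le_div_iff₀' (by positivity)]
      refine ih c (fun j S => F j (insert x S))
        (fun j S T hST => hF j _ _ (insert_subset_insert x hST)) fun f hfU hf => ?_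
      have h := hc (fun j => insert x (f j)) (fun j => insert_subset_insert x (hfU j)) hf
      have hsub : {y ∈ insert x U | ∃ i j, i ≠ j ∧ y ∈ insert x (f i) ∧ y ∈ insert x (f j)} ⊆
          insert x {y ∈ U | ∃ i j, i ≠ j ∧ y ∈ f i ∧ y ∈ f j} := by
        intro y
        simp only [mem_filter, mem_insert]
        grind
      have := h.trans ((card_le_card hsub).trans (card_insert_le _ _))
      omega

end biasedMeasure

section Coloring

open Finset

variable {V : Type*} [DecidableEq V] {p : ℕ} {G : Finset (Finset V)}

/-- If `p` hyperedges have at most `p ^ 2` elements lying in two or more of them, two colorings with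
`p ^ 2` colors suffice. -/
theorem exists_colorings_of_card_le (hp : 2 ≤ p) (hG : IsIntersecting p G)
    {f : Fin p → Finset V} (hf : ∀ i, f i ∈ G) {Q : Finset V} (hQ : #Q ≤ p ^ 2)
    (hfQ : ∀ i j, i ≠ j → f i ∩ f j ⊆ Q) :
    ∃ h₁ h₂ : V → Fin (p ^ 2), ∀ e ∈ G, p ≤ #(e.image h₁) ∨ p ≤ #(e.image h₂) := by
  have hpp : p ≤ p ^ 2 := Nat.le_self_pow two_ne_zero p
  obtain ⟨φ⟩ : Nonempty (Q ↪ Fin (p ^ 2)) :=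
    Function.Embedding.nonempty_of_card_le (by simpa using hQ)
  have hcol : ∀ x, ∃ c : Fin p, x ∉ Q → ∀ a, x ∈ f a → c = a := fun x => by
    by_cases h : ∃ a, x ∈ f a
    · obtain ⟨a, ha⟩ := h
      refine ⟨a, fun hx b hb => ?_⟩
      by_contra hab
      exact hx (hfQ a b hab (mem_inter.2 ⟨ha, hb⟩))
    · exact ⟨⟨0, by omega⟩, fun _ a ha => (h ⟨a, ha⟩).elim⟩
  choose c hc using hcol
  set h₁ : V → Fin (p ^ 2) := fun x => if h : x ∈ Q then φ ⟨x, h⟩ else ⟨0, by positivity⟩ with hh₁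
  have hinj : Set.InjOn h₁ Q := fun x hx y hy hxy => by
    have hx : x ∈ Q := hx
    have hy : y ∈ Q := hy
    simpa [hh₁, hx, hy] using hxy
  refine ⟨h₁, fun x => Fin.castLE hpp (c x), fun e he => or_iff_not_imp_left.2 fun hlt => ?_⟩
  have hle : #(e ∩ Q) ≤ #(e.image h₁) := by
    rw [← card_image_of_injOn (hinj.mono (by simp : (↑(e ∩ Q) : Set V) ⊆ Q))]
    exact card_le_card (image_subset_image inter_subset_left)
  have hsub : univ.image (Fin.castLE hpp) ⊆ e.image fun x => Fin.castLE hpp (c x) := by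
    intro y hy
    obtain ⟨a, -, rfl⟩ := mem_image.1 hy
    have : ¬ e ∩ f a ⊆ e ∩ Q := fun h => by
      have := (hG e he (f a) (hf a)).trans (card_le_card h)
      omega
    obtain ⟨x, hx, hxQ⟩ := not_subset.1 this
    rw [mem_inter] at hx hxQ
    exact mem_image.2 ⟨x, hx.1, by rw [hc x (fun h => hxQ ⟨hx.1, h⟩) a hx.2]⟩
  have := card_le_card hsub
  rwa [card_image_of_injective _ (Fin.castLE_injective hpp), card_univ, Fintype.card_fin] at this

variable [Fintype V]

theorem card_filter_preimage {α : Type*} [Fintype α] [DecidableEq α] [Nonempty α]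
    (D : Finset α) (F : Finset V → Prop) [DecidablePred F] :
    (#{H : V → α | F {x | H x ∈ D}} : ℝ) = (Fintype.card α : ℝ) ^ Fintype.card V *
      biasedMeasure ((#D : ℝ) / Fintype.card α) univ F := by
  have hfib (S : Finset V) : #{H : V → α | ({x | H x ∈ D} : Finset V) = S} =
      #D ^ #S * (Fintype.card α - #D) ^ (Fintype.card V - #S) := by
    have : ({H : V → α | ({x | H x ∈ D} : Finset V) = S} : Finset (V → α)) =
        Fintype.piFinset fun x => if x ∈ S then D else Dᶜ := by
      ext H
      simp only [mem_filter, mem_univ, true_and, Fintype.mem_piFinset, Finset.ext_iff]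
      refine forall_congr' fun x => ?_
      split_ifs with h <;> simp [h]
    rw [this, Fintype.card_piFinset]
    simp only [apply_ite card, prod_ite, prod_const, card_compl, filter_mem_eq_inter, univ_inter]
    rw [filter_not, filter_mem_eq_inter, univ_inter, card_sdiff_of_subset (subset_univ S),
      card_univ]
  have hα : (Fintype.card α : ℝ) ≠ 0 := by exact_mod_cast Fintype.card_ne_zero
  rw [card_eq_sum_card_fiberwise (t := univ.powerset)
    (f := fun H : V → α => ({x | H x ∈ D} : Finset V)) fun _ _ => by simp,
    biasedMeasure, mul_sum, Nat.cast_sum]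
  refine sum_congr rfl fun S _ => ?_
  rw [filter_filter]
  by_cases hS : F S
  · rw [if_pos hS, filter_congr (q := fun H : V → α => ({x | H x ∈ D} : Finset V) = S)
      fun H _ => ⟨And.right, fun h => ⟨h ▸ hS, h⟩⟩, hfib]
    have hV : #S + (Fintype.card V - #S) = Fintype.card V := Nat.add_sub_of_le (card_le_univ S)
    rw [card_univ]
    nth_rewrite 2 [← hV]
    rw [Nat.cast_mul, Nat.cast_pow, Nat.cast_pow, Nat.cast_sub (card_le_univ D), pow_add,
      mul_mul_mul_comm, ← mul_pow, ← mul_pow]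
    congr 2 <;> field_simp
  · rw [if_neg hS, mul_zero, filter_false_of_mem, card_empty, Nat.cast_zero]
    rintro H - ⟨hH, rfl⟩
    exact hS hH

/-- If any `p` hyperedges have at least `p ^ 2` elements lying in two or more of them, a random pair
of colorings works with positive probability. -/
theorem exists_colorings_of_le_card (hp : 2 ≤ p)
    (hG : ∀ f : Fin p → Finset V, (∀ i, f i ∈ G) →
      p ^ 2 ≤ #{x | ∃ i j, i ≠ j ∧ x ∈ f i ∧ x ∈ f j}) :
    ∃ h₁ h₂ : V → Fin (p ^ 2), ∀ e ∈ G, p ≤ #(e.image h₁) ∨ p ≤ #(e.image h₂) := by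
  classical
  by_contra! hno
  set F : Finset V → Prop := fun S => ∃ e ∈ G, e ⊆ S
  have : NeZero (p ^ 2) := ⟨by positivity⟩
  set s : ℝ := ((p - 1 : ℕ) * (p - 1 : ℕ) : ℕ) / (p ^ 2 * p ^ 2 : ℕ) with hs
  set P := powersetCard (p - 1) (univ : Finset (Fin (p ^ 2)))
  have hp0 : (0 : ℝ) < p := by positivity
  have hs0 : 0 ≤ s := by positivity
  have hs1 : s * ((p : ℝ) + 1) ^ 2 ≤ 1 := by
    rw [hs, div_mul_eq_mul_div, div_le_one (by positivity)]
    push_cast [Nat.cast_sub (show 1 ≤ p by omega)]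
    have hp1 : (1 : ℝ) ≤ p := by exact_mod_cast (show 1 ≤ p by omega)
    calc ((p : ℝ) - 1) * (p - 1) * ((p : ℝ) + 1) ^ 2 = ((p : ℝ) ^ 2 - 1) ^ 2 := by ring
      _ ≤ ((p : ℝ) ^ 2) ^ 2 := by gcongr <;> nlinarith
      _ = _ := by ring
  have hcover : (univ : Finset (V → Fin (p ^ 2) × Fin (p ^ 2))) ⊆
      (P ×ˢ P).biUnion fun D => {H | F {x | H x ∈ D.1 ×ˢ D.2}} := by
    intro H _
    obtain ⟨e, he, h₁, h₂⟩ := hno (fun x => (H x).1) fun x => (H x).2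
    have hext (I : Finset (Fin (p ^ 2))) (hI : #I < p) : ∃ A ∈ P, I ⊆ A := by
      obtain ⟨A, hIA, hA⟩ := exists_superset_card_eq (s := I) (n := p - 1) (by omega) (by
        rw [Fintype.card_fin]; nlinarith [Nat.sub_le p 1])
      exact ⟨A, mem_powersetCard_univ.2 hA, hIA⟩
    obtain ⟨A, hA, hAe⟩ := hext _ h₁
    obtain ⟨B, hB, hBe⟩ := hext _ h₂
    rw [mem_biUnion]
    refine ⟨(A, B), mk_mem_product hA hB, mem_filter.2 ⟨mem_univ _, e, he, fun x hx => ?_⟩⟩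
    exact mem_filter.2 ⟨mem_univ _, mem_product.2
      ⟨hAe (mem_image_of_mem _ hx), hBe (mem_image_of_mem _ hx)⟩⟩
  have hcount := (card_le_card hcover).trans card_biUnion_le
  have hD : ∀ D ∈ P ×ˢ P, (#{H : V → Fin (p ^ 2) × Fin (p ^ 2) | F {x | H x ∈ D.1 ×ˢ D.2}} : ℝ) =
      ((p ^ 2 * p ^ 2 : ℕ) : ℝ) ^ Fintype.card V * biasedMeasure s univ F := fun D hD => by
    obtain ⟨hA, hB⟩ := mem_product.1 hD
    refine (card_filter_preimage (D.1 ×ˢ D.2) F).trans ?_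
    rw [card_product, mem_powersetCard_univ.1 hA, mem_powersetCard_univ.1 hB,
      Fintype.card_prod, Fintype.card_fin]
  have hμ : 1 ≤ ((p ^ 2).choose (p - 1) ^ 2 : ℕ) * biasedMeasure s univ F := by
    have h : ((p ^ 2 * p ^ 2 : ℕ) : ℝ) ^ Fintype.card V * 1 ≤
        ((p ^ 2 * p ^ 2 : ℕ) : ℝ) ^ Fintype.card V *
          (((p ^ 2).choose (p - 1) ^ 2 : ℕ) * biasedMeasure s univ F) := by
      have h := (Nat.cast_le (α := ℝ)).2 hcount
      rw [Nat.cast_sum, sum_congr rfl hD, sum_const, card_product, card_powersetCard, card_univ,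
        card_univ, Fintype.card_fun, Fintype.card_prod, Fintype.card_fin, nsmul_eq_mul,
        Nat.cast_pow, ← sq (Nat.choose _ _)] at h
      linarith
    exact le_of_mul_le_mul_left h (by positivity)
  have hprod := pow_mul_prod_biasedMeasure_le_one hp hs0 hs1 univ (p ^ 2) (fun _ => F)
    (fun _ S T hST ⟨e, he, heS⟩ => ⟨e, he, heS.trans hST⟩) fun f _ hf => by
      choose e he hef using hf
      refine (hG e he).trans (card_le_card (monotone_filter_right _ ?_))
      rintro x - ⟨i, j, hij, hi, hj⟩
      exact ⟨i, j, hij, hef i hi, hef j hj⟩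
  rw [prod_const, card_univ, Fintype.card_fin, sq p, pow_mul _ p p, ← mul_pow, ← pow_mul] at hprod
  have hμ0 : 0 < biasedMeasure s univ F := by
    by_contra! h
    linarith [mul_nonpos_of_nonneg_of_nonpos
      (Nat.cast_nonneg (α := ℝ) ((p ^ 2).choose (p - 1) ^ 2)) h]
  have hle : (p : ℝ) ^ (3 * p) * biasedMeasure s univ F ≤ 1 :=
    (pow_le_one_iff_of_nonneg (by positivity) (by omega)).1 hprod
  have hlt : (((p ^ 2).choose (p - 1) ^ 2 : ℕ) : ℝ) < (p : ℝ) ^ (3 * p) := by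
    exact_mod_cast choose_sq_lt_pow p hp
  nlinarith

end Coloring

/-- Theorem 1 (specialized form): if `t ≥ p ≥ 2` and `b > (p-1)(t+1)`, then every
`t`-intersecting hypergraph admits two hash functions into `[b]` such that every hyperedge
receives at least `p` values under one of them; i.e. `λ(t,p,b) ≤ 2`. -/
theorem partially_perfect_two_functions
    (t p b : ℕ) (htp : t ≥ p) (hp : p ≥ 2) (hb : b > (p - 1) * (t + 1))
    (V : Type*) [Fintype V] [DecidableEq V]
    (G : Finset (Finset V)) (hG : IsIntersecting t G) :
    ∃ h₁ h₂ : V → Fin b, ∀ e ∈ G,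
      p ≤ (e.image h₁).card ∨ p ≤ (e.image h₂).card := by
  have hbp : p ^ 2 ≤ b := by
    obtain ⟨k, rfl⟩ : ∃ k, p = k + 1 := ⟨p - 1, by omega⟩
    rw [Nat.add_sub_cancel] at hb
    nlinarith [Nat.mul_le_mul_left k htp]
  have hGp : IsIntersecting p G := fun e₁ h₁ e₂ h₂ => htp.le.trans (hG e₁ h₁ e₂ h₂)
  obtain ⟨h₁, h₂, h⟩ : ∃ h₁ h₂ : V → Fin (p ^ 2), ∀ e ∈ G,
      p ≤ (e.image h₁).card ∨ p ≤ (e.image h₂).card := by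
    by_cases hsmall : ∃ f : Fin p → Finset V, (∀ i, f i ∈ G) ∧
        (Finset.univ.filter fun x => ∃ i j, i ≠ j ∧ x ∈ f i ∧ x ∈ f j).card ≤ p ^ 2
    · obtain ⟨f, hf, hQ⟩ := hsmall
      refine exists_colorings_of_card_le hp hGp hf hQ fun i j hij x hx => ?_
      exact Finset.mem_filter.2
        ⟨Finset.mem_univ x, i, j, hij, Finset.mem_inter.1 hx⟩
    · push Not at hsmall
      exact exists_colorings_of_le_card hp fun f hf => (hsmall f hf).le
  refine ⟨Fin.castLE hbp ∘ h₁, Fin.castLE hbp ∘ h₂, fun e he => ?_⟩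
  simp only [← Finset.image_image, Finset.card_image_of_injective _ (Fin.castLE_injective hbp)]
  exact h e he
end

section
/- For all integers t, p, b with t ≥ p ≥ 2 and b > (p-1)(t+1), the inequality C(b, p-1) · ((p-1)/b)^(2t) < 1 holds, where C(b, p-1) denotes the binomial coefficient. -/
/-- The arithmetic fact specializing the general bound to `x = 2`: for `t ≥ p ≥ 2` and
`b > (p-1)(t+1)`, we have `C(b, p-1)·((p-1)/b)^(2t) < 1`. -/
theorem choose_mul_pow_lt_one
    (t p b : ℕ) (htp : t ≥ p) (hp : p ≥ 2) (hb : b > (p - 1) * (t + 1)) :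
    (b.choose (p - 1) : ℝ) * (((p - 1 : ℕ) : ℝ) / (b : ℝ)) ^ (2 * t) < 1 := by
  obtain ⟨k, rfl⟩ : ∃ k, p = k + 1 := ⟨p - 1, by omega⟩
  simp only [Nat.add_sub_cancel] at hb ⊢
  have hk_sq : k * k < b := by nlinarith
  have hk_le : k ≤ b := by nlinarith
  have hb_pos : (0 : ℝ) < b := by exact_mod_cast (Nat.zero_le _).trans_lt hb
  have h_ratio : (k : ℝ) / b ≤ 1 := div_le_one_of_le₀ (by exact_mod_cast hk_le) hb_pos.le
  calc (b.choose k : ℝ) * ((k : ℝ) / b) ^ (2 * t)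
      ≤ (b : ℝ) ^ k * ((k : ℝ) / b) ^ (2 * k) := by
        gcongr ?_ * ?_
        · exact_mod_cast Nat.choose_le_pow b k
        · exact pow_le_pow_of_le_one (by positivity) h_ratio (by omega)
    _ = ((k * k : ℝ) / b) ^ k := by
        rw [pow_mul, ← mul_pow]
        congr 1
        field_simp
    _ < 1 := by
        refine pow_lt_one₀ (by positivity) ?_ (by omega)
        rw [div_lt_one hb_pos]
        exact_mod_cast hk_sq
end

section
/- For every 1-intersecting hypergraph G on a finite vertex set V, there exist two functions h_1, h_2 : V → [2] such that for every hyperedge e of G, |h_1(e)| ≥ min(2, |e|) or |h_2(e)| ≥ min(2, |e|); equivalently, λ(1,2,2) ≤ 2. -/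
/-- A function that is not partially `2`-perfect with respect to a finset is constant on it. -/
theorem eq_of_card_image_lt_min_two {V W : Type*} [DecidableEq W] {e : Finset V} {h : V → W}
    (he : (e.image h).card < min 2 e.card) {x y : V} (hx : x ∈ e) (hy : y ∈ e) : h x = h y :=
  Finset.card_le_one.mp (by omega) _ (Finset.mem_image_of_mem h hx) _
    (Finset.mem_image_of_mem h hy)

/-- Upper bound in Proposition 1: for every `1`-intersecting hypergraph there are two hash
functions into `[2]` such that every hyperedge is partially `2`-perfect with respect to one
of them; i.e. `λ(1,2,2) ≤ 2`. -/
theorem lambda_one_two_two_le_two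
    (V : Type*) [Fintype V] [DecidableEq V]
    (G : Finset (Finset V)) (hG : IsIntersecting 1 G) :
    ∃ h₁ h₂ : V → Fin 2, ∀ e ∈ G,
      min 2 e.card ≤ (e.image h₁).card ∨ min 2 e.card ≤ (e.image h₂).card := by
  by_cases hne : (G.filter (2 ≤ ·.card)).Nonempty
  · obtain ⟨e, he, hmin⟩ := Finset.exists_min_image _ Finset.card hne
    obtain ⟨heG, he2⟩ := Finset.mem_filter.mp he
    obtain ⟨v, hv⟩ := Finset.card_pos.mp (by omega : 0 < e.card)
    refine ⟨fun x => if x = v then 1 else 0, fun x => if x ∈ e then 1 else 0, fun f hf => ?_⟩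
    by_contra! hcon
    obtain ⟨h₁, h₂⟩ := hcon
    obtain ⟨w, hw⟩ := Finset.card_pos.mp (hG f hf e heG)
    obtain ⟨hwf, hwe⟩ := Finset.mem_inter.mp hw
    have hf2 : 2 ≤ f.card := by
      have := Finset.card_pos.mpr
        (Finset.Nonempty.image ⟨w, hwf⟩ fun x => if x = v then (1 : Fin 2) else 0)
      omega
    have hvf : v ∉ f := fun hvf => by
      obtain ⟨u, hu, huv⟩ := Finset.exists_mem_ne (by omega : 1 < f.card) v
      simpa [huv] using eq_of_card_image_lt_min_two h₁ hu hvf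
    have hsub : f ⊆ e := fun x hx => by
      by_contra hxe
      simpa [hxe, hwe] using eq_of_card_image_lt_min_two h₂ hx hwf
    have hlt := Finset.card_lt_card
      (Finset.ssubset_iff_subset_ne.mpr ⟨hsub, fun h => hvf (h ▸ hv)⟩)
    exact absurd (hmin f (Finset.mem_filter.mpr ⟨hf, hf2⟩)) (by omega)
  · refine ⟨fun _ => 0, fun _ => 0, fun e he => Or.inl ?_⟩
    have hle : e.card < 2 := by
      by_contra! h
      exact hne ⟨e, Finset.mem_filter.mpr ⟨he, h⟩⟩
    have hpos : 0 < e.card := by simpa using hG e he e he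
    have := Finset.card_pos.mpr ((Finset.card_pos.mp hpos).image fun _ => (0 : Fin 2))
    omega
end

section
/- For every 2-intersecting hypergraph G on a finite vertex set V, there exists a single function h : V → [2] such that every hyperedge e of G satisfies |h(e)| ≥ min(2, |e|), i.e., no hyperedge with at least two vertices is monochromatic under h. Consequently λ(t,2,2) = 1 for every t ≥ 2. -/
/-- Greedy colouring: the vertices of `S` can be coloured so that no hyperedge inside `S` is
monochromatic, because two hyperedges blocking both colours of a new vertex `v` would meet
only in `v`. -/
theorem IsIntersecting.exists_nonmonochromatic_on {V : Type*} [DecidableEq V]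
    {G : Finset (Finset V)} (hG : IsIntersecting 2 G) (S : Finset V) :
    ∃ h : V → Fin 2, ∀ e ∈ G, e ⊆ S → ∃ x ∈ e, ∃ y ∈ e, h x ≠ h y := by
  induction S using Finset.induction_on with
  | empty =>
    refine ⟨fun _ => 0, fun e he hS => ?_⟩
    have hcard := hG e he e he
    simp [Finset.subset_empty.mp hS] at hcard
  | insert v S _ ih =>
    obtain ⟨h, hh⟩ := ih
    by_contra! hcon
    have blocked : ∀ c : Fin 2, ∃ e ∈ G, ∀ x ∈ e, x ≠ v → h x = c := by
      intro c
      obtain ⟨e, he, hS, hmono⟩ := hcon (Function.update h v c)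
      have hv : v ∈ e := by
        by_contra hv
        obtain ⟨x, hx, y, hy, hxy⟩ := hh e he ((Finset.subset_insert_iff_of_notMem hv).mp hS)
        have hxv : x ≠ v := fun hxv => hv (hxv ▸ hx)
        have hyv : y ≠ v := fun hyv => hv (hyv ▸ hy)
        exact hxy (by simpa [hxv, hyv] using hmono x hx y hy)
      exact ⟨e, he, fun x hx hxv => by simpa [hxv] using hmono x hx v hv⟩
    obtain ⟨e, he, he_color⟩ := blocked 0
    obtain ⟨f, hf, hf_color⟩ := blocked 1
    obtain ⟨x, hx, hxv⟩ := Finset.exists_mem_ne (hG e he f hf) v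
    rw [Finset.mem_inter] at hx
    exact zero_ne_one ((he_color x hx.1 hxv).symm.trans (hf_color x hx.2 hxv))

/-- Proposition 2: every `2`-intersecting hypergraph admits a single hash function into
`[2]` that is partially `2`-perfect for every hyperedge; i.e. `λ(t,2,2) = 1` for `t ≥ 2`. -/
theorem lambda_two_two_two_eq_one
    (V : Type*) [Fintype V] [DecidableEq V]
    (G : Finset (Finset V)) (hG : IsIntersecting 2 G) :
    ∃ h : V → Fin 2, ∀ e ∈ G, min 2 e.card ≤ (e.image h).card := by
  obtain ⟨h, hh⟩ := hG.exists_nonmonochromatic_on Finset.univ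
  refine ⟨h, fun e he => (min_le_left _ _).trans ?_⟩
  obtain ⟨x, hx, y, hy, hxy⟩ := hh e he (Finset.subset_univ e)
  exact Finset.one_lt_card.mpr
    ⟨h x, Finset.mem_image_of_mem h hx, h y, Finset.mem_image_of_mem h hy, hxy⟩
end

section
/- Let b ≥ 3 be an integer. For every 1-intersecting hypergraph G on a finite vertex set V, there exists a single function h : V → [b] such that every hyperedge e of G satisfies |h(e)| ≥ min(2, |e|). Consequently λ(1,2,b) = 1 for all b ≥ 3. -/
/-- Proposition 3: for `b ≥ 3`, every `1`-intersecting hypergraph admits a single hash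
function into `[b]` that is partially `2`-perfect for every hyperedge; i.e.
`λ(1,2,b) = 1` for `b ≥ 3`. -/
theorem lambda_one_two_b_eq_one
    (b : ℕ) (hb : b ≥ 3)
    (V : Type*) [Fintype V] [DecidableEq V]
    (G : Finset (Finset V)) (hG : IsIntersecting 1 G) :
    ∃ h : V → Fin b, ∀ e ∈ G, min 2 e.card ≤ (e.image h).card := by
  rcases G.eq_empty_or_nonempty with rfl | hne
  · exact ⟨fun _ => ⟨0, by omega⟩, by simp⟩
  obtain ⟨e, he, hmin⟩ := G.exists_min_image Finset.card hne
  obtain ⟨x, hx⟩ : e.Nonempty :=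
    (Finset.card_pos.mp (hG e he e he)).mono Finset.inter_subset_left
  refine ⟨fun v => if v = x then ⟨0, by omega⟩ else
    if v ∈ e then ⟨1, by omega⟩ else ⟨2, by omega⟩, fun f hf => ?_⟩
  by_contra! hlt
  obtain ⟨y, hy⟩ := Finset.card_pos.mp (hG f hf e he)
  obtain ⟨hyf, hye⟩ := Finset.mem_inter.mp hy
  have hcol := Nat.le_of_lt_succ (lt_min_iff.mp hlt).1
  have hcard : 2 ≤ f.card := lt_of_le_of_lt
    (Finset.card_pos.mpr (Finset.Nonempty.image ⟨y, hyf⟩ _)) (lt_min_iff.mp hlt).2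
  have hmono := fun z (hz : z ∈ f) => Finset.card_le_one.mp hcol _ (Finset.mem_image_of_mem _ hz)
    _ (Finset.mem_image_of_mem _ hyf)
  by_cases hyx : y = x
  · have hsub : f ⊆ {x} := fun z hz => by
      have := hmono z hz
      rw [Finset.mem_singleton]
      by_contra hzx
      by_cases hze : z ∈ e <;> simp [hyx, hzx, hze] at this
    simpa using hcard.trans (Finset.card_le_card hsub)
  · have hsub : f ⊆ e.erase x := fun z hz => by
      have := hmono z hz
      rw [Finset.mem_erase]
      by_cases hzx : z = x <;> by_cases hze : z ∈ e <;> simp_all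
    exact absurd (hmin f hf) (not_le.mpr
      ((Finset.card_le_card hsub).trans_lt (Finset.card_erase_lt_of_mem hx)))
end

section
/- Let t ≥ 0, p ≥ t+2, b ≥ 1 and x ≥ 1 be integers. Then there exists a finite t-intersecting hypergraph G on some vertex set [n] such that for every family of x functions h_1, …, h_x : [n] → [b], some hyperedge e of G satisfies |h_i(e)| < min(p, |e|) for every i. Consequently λ(t, p, b) = ∞ whenever p − t ≥ 2; in particular λ(0, p, b) = ∞ for all p ≥ 2. -/
/-- Corollary 2: if `p ≥ t + 2` then no finite number `x` of hash functions into `[b]`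
suffices for all `t`-intersecting hypergraphs: there is a `t`-intersecting hypergraph for
which every family of `x` functions fails to be partially `p`-perfect on some hyperedge.
Hence `λ(t,p,b) = ∞` whenever `p - t ≥ 2`; in particular `λ(0,p,b) = ∞` for `p ≥ 2`. -/
theorem lambda_infinite_of_p_ge_t_add_two
    (t p b x : ℕ) (hp : p ≥ t + 2) (hb : b ≥ 1) (hx : x ≥ 1) :
    ∃ (n : ℕ) (G : Finset (Finset (Fin n))), IsIntersecting t G ∧
      ∀ h : Fin x → Fin n → Fin b,
        ∃ e ∈ G, ∀ i : Fin x, (e.image (h i)).card < min p e.card := by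
  classical
  obtain ⟨C, -, hC⟩ := Finset.exists_subset_card_eq
    (s := (Finset.univ : Finset (Fin (t + b ^ x + 1)))) (n := t)
    (by rw [Finset.card_univ, Fintype.card_fin]; omega)
  refine ⟨t + b ^ x + 1, Finset.univ.filter (C ⊆ ·), ?_, fun h => ?_⟩
  · intro e₁ h₁ e₂ h₂
    exact hC.ge.trans (Finset.card_le_card
      (Finset.subset_inter (Finset.mem_filter.1 h₁).2 (Finset.mem_filter.1 h₂).2))
  · obtain ⟨u, v, huv, heq⟩ := Fintype.exists_ne_map_eq_of_card_lt
      (fun w : Fin (t + b ^ x + 1) => fun i => h i w)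
      (by simp only [Fintype.card_fun, Fintype.card_fin]; omega)
    refine ⟨insert u (insert v C), Finset.mem_filter.2 ⟨Finset.mem_univ _, ?_⟩, fun i => ?_⟩
    · exact (Finset.subset_insert v C).trans (Finset.subset_insert u _)
    · have hcard : (insert u (insert v C)).card ≤ p := by
        have h₁ := Finset.card_insert_le u (insert v C)
        have h₂ := Finset.card_insert_le v C
        omega
      rw [min_eq_right hcard]
      refine lt_of_le_of_ne Finset.card_image_le fun hc => huv ?_
      exact Finset.card_image_iff.1 hc (by simp) (by simp) (congrFun heq i)
end

section
/- Let p ≥ 2 and let b be an integer with p ≤ b ≤ 2p−2. Let G be the complete (2p−2)-uniform hypergraph on a vertex set V of size 3p−3 (its hyperedges are all subsets of V of size 2p−2). Then G is (p−1)-intersecting, and for every function h : V → [b] there exists a hyperedge e of G with |h(e)| ≤ p−1. Consequently λ(p−1, p, b) ≥ 2 for p ≤ b ≤ 2p−2. -/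
/-- If `n` points receive at most `2 * k` colours and `3 * k ≤ n`, then some `k` colours
(when at least `k` are available) cover at least `2 * k` of the points. -/
theorem exists_colors_two_mul_le_card_preimage {V C : Type*} [Fintype V] [Fintype C]
    [DecidableEq C] (k : ℕ) (hk : k ≤ Fintype.card C) (hC : Fintype.card C ≤ 2 * k)
    (hV : 3 * k ≤ Fintype.card V) (h : V → C) :
    ∃ T : Finset C, T.card = k ∧ 2 * k ≤ (Finset.univ.filter fun v => h v ∈ T).card := by
  classical
  have preimage_card (T : Finset C) : (Finset.univ.filter fun v => h v ∈ T).card =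
      ∑ c ∈ T, (Finset.univ.filter fun v => h v = c).card := by
    rw [Finset.card_eq_sum_card_fiberwise (f := h) (t := T) (fun v hv => by simpa using hv)]
    refine Finset.sum_congr rfl fun c hc => congrArg Finset.card ?_
    ext v
    simp only [Finset.mem_filter, Finset.mem_univ, true_and, and_iff_right_iff_imp]
    rintro rfl
    exact hc
  let S : Finset C :=
    Finset.univ.filter fun c => 2 ≤ (Finset.univ.filter fun v => h v = c).card
  rcases le_total k S.card with hkS | hkS
  · obtain ⟨T, hTS, hT⟩ := Finset.exists_subset_card_eq hkS
    refine ⟨T, hT, ?_⟩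
    rw [preimage_card, mul_comm, ← hT, ← smul_eq_mul]
    exact Finset.card_nsmul_le_sum _ _ _ fun c hc => (Finset.mem_filter.mp (hTS hc)).2
  · obtain ⟨T, hST, hT⟩ := Finset.exists_superset_card_eq hkS hk
    refine ⟨T, hT, ?_⟩
    have hcompl : (Finset.univ.filter fun v => h v ∈ Tᶜ).card ≤ Tᶜ.card := by
      rw [preimage_card, Finset.card_eq_sum_ones]
      refine Finset.sum_le_sum fun c hc => ?_
      by_contra! hlt
      exact Finset.mem_compl.mp hc (hST (Finset.mem_filter.mpr ⟨Finset.mem_univ c, hlt⟩))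
    have hsplit := Finset.card_filter_add_card_filter_not (s := Finset.univ) (fun v => h v ∈ T)
    simp only [Finset.mem_compl] at hcompl
    rw [Finset.card_compl] at hcompl
    rw [Finset.card_univ] at hsplit
    omega


/-- Theorem 3: for `p ≥ 2` and `p ≤ b ≤ 2p-2`, the complete `(2p-2)`-uniform hypergraph on
`3p-3` vertices is `(p-1)`-intersecting, and for every hash function into `[b]` some
hyperedge receives at most `p-1` values. Hence `λ(p-1, p, b) ≥ 2`. -/
theorem lambda_p_sub_one_p_b_ge_two
    (p b : ℕ) (hp : p ≥ 2) (hbl : p ≤ b) (hbu : b ≤ 2 * p - 2)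
    (V : Type*) [Fintype V] [DecidableEq V] (hV : Fintype.card V = 3 * p - 3) :
    IsIntersecting (p - 1) (Finset.powersetCard (2 * p - 2) (Finset.univ : Finset V)) ∧
    ∀ h : V → Fin b,
      ∃ e ∈ Finset.powersetCard (2 * p - 2) (Finset.univ : Finset V),
        (e.image h).card ≤ p - 1 := by
  constructor
  · intro e₁ he₁ e₂ he₂
    rw [Finset.mem_powersetCard_univ] at he₁ he₂
    have hunion := Finset.card_union_add_card_inter e₁ e₂
    have hle := Finset.card_le_univ (e₁ ∪ e₂)
    omega
  · intro h
    obtain ⟨T, hT, hcard⟩ := exists_colors_two_mul_le_card_preimage (p - 1)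
      (by rw [Fintype.card_fin]; omega) (by rw [Fintype.card_fin]; omega) (by omega) h
    obtain ⟨e, heT, he⟩ := Finset.exists_subset_card_eq
      (show 2 * p - 2 ≤ (Finset.univ.filter fun v => h v ∈ T).card by omega)
    refine ⟨e, Finset.mem_powersetCard_univ.mpr he, hT ▸ Finset.card_le_card ?_⟩
    exact Finset.image_subset_iff.mpr fun v hv => (Finset.mem_filter.mp (heT hv)).2
end

section
/- Let t ≥ p ≥ 3 and let b be an integer with p ≤ b ≤ 2p−3. Let G be the complete (pt)-uniform hypergraph on a vertex set V of size 2pt−t (its hyperedges are all subsets of V of size pt). Then G is t-intersecting, and for every function h : V → [b] there exists a hyperedge e of G with |h(e)| ≤ p−1. Consequently λ(t, p, b) ≥ 2 for p ≤ b ≤ 2p−3 and t ≥ p. -/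
/-- Some `k`-element subset of `s` has average at least the average of `f` over `s`. -/
lemma exists_subset_card_eq_mul_sum_le {ι : Type*} [DecidableEq ι] (f : ι → ℕ) (k : ℕ)
    (s : Finset ι) (hk : k ≤ s.card) :
    ∃ S ⊆ s, S.card = k ∧ k * ∑ i ∈ s, f i ≤ s.card * ∑ i ∈ S, f i := by
  induction s using Finset.strongInduction with
  | H s ih =>
    rcases hk.eq_or_lt with rfl | hlt
    · exact ⟨s, subset_rfl, rfl, le_rfl⟩
    obtain ⟨m, hm, hmin⟩ := s.exists_min_image f (Finset.card_pos.mp (by omega))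
    have hcard := Finset.card_erase_add_one hm
    have hsum := Finset.add_sum_erase s f hm
    obtain ⟨S, hSs, hS, hle⟩ := ih _ (Finset.erase_ssubset hm) (by omega)
    refine ⟨S, hSs.trans (Finset.erase_subset _ _), hS, ?_⟩
    have hmul : (s.erase m).card * f m ≤ ∑ i ∈ s.erase m, f i := by
      simpa using Finset.card_nsmul_le_sum (s.erase m) f (f m)
        fun i hi => hmin i (Finset.mem_of_mem_erase hi)
    rw [← hcard, ← hsum]
    rcases Nat.eq_zero_or_pos (s.erase m).card with h0 | hpos
    · have : k = 0 := by omega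
      simp [this]
    · refine Nat.le_of_mul_le_mul_left ?_ hpos
      nlinarith [Nat.mul_le_mul_left k hmul,
        Nat.mul_le_mul_left ((s.erase m).card + 1) hle]

/-- Among `b` colour classes, some `k` of them together contain at least a `k / b` fraction of
the vertices. -/
lemma exists_card_eq_mul_card_le_card_filter {V : Type*} [Fintype V] {b : ℕ} (h : V → Fin b)
    {k : ℕ} (hk : k ≤ b) :
    ∃ S : Finset (Fin b), S.card = k ∧
      k * Fintype.card V ≤ b * (Finset.univ.filter fun v => h v ∈ S).card := by
  obtain ⟨S, -, hS, hle⟩ := exists_subset_card_eq_mul_sum_le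
    (fun i => (Finset.univ.filter fun v => h v = i).card) k Finset.univ (by simpa using hk)
  refine ⟨S, hS, ?_⟩
  rw [← Finset.card_eq_sum_card_fiberwise (fun _ _ => Finset.mem_coe.2 (Finset.mem_univ _)),
    Finset.card_univ, Finset.card_univ, Fintype.card_fin] at hle
  refine hle.trans_eq ?_
  rw [Finset.card_eq_sum_card_fiberwise (f := h) (t := S)
    (fun v hv => by simpa using hv)]
  congr 1
  refine Finset.sum_congr rfl fun i hi => ?_
  congr 1
  ext v
  simp only [Finset.mem_filter, Finset.mem_univ, true_and]
  exact ⟨fun hv => ⟨hv ▸ hi, hv⟩, fun hv => hv.2⟩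

/-- Theorem 4: for `t ≥ p ≥ 3` and `p ≤ b ≤ 2p-3`, the complete `pt`-uniform hypergraph on
`2pt - t` vertices is `t`-intersecting, and for every hash function into `[b]` some
hyperedge receives at most `p-1` values. Hence `λ(t, p, b) ≥ 2`. -/
theorem lambda_t_p_b_ge_two
    (t p b : ℕ) (htp : t ≥ p) (hp : p ≥ 3) (hbl : p ≤ b) (hbu : b ≤ 2 * p - 3)
    (V : Type*) [Fintype V] [DecidableEq V] (hV : Fintype.card V = 2 * p * t - t) :
    IsIntersecting t (Finset.powersetCard (p * t) (Finset.univ : Finset V)) ∧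
    ∀ h : V → Fin b,
      ∃ e ∈ Finset.powersetCard (p * t) (Finset.univ : Finset V),
        (e.image h).card ≤ p - 1 := by
  have ht : t ≤ 2 * p * t := by nlinarith
  constructor
  · intro e₁ h₁ e₂ h₂
    have hadd := Finset.card_union_add_card_inter e₁ e₂
    have hunion := Finset.card_le_univ (e₁ ∪ e₂)
    rw [(Finset.mem_powersetCard.1 h₁).2, (Finset.mem_powersetCard.1 h₂).2] at hadd
    have : 2 * p * t = p * t + p * t := by ring
    omega
  · intro h
    obtain ⟨S, hS, hle⟩ := exists_card_eq_mul_card_le_card_filter h (k := p - 1) (by omega)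
    have hcard : p * t ≤ (Finset.univ.filter fun v => h v ∈ S).card := by
      by_contra! hlt
      obtain ⟨q, rfl⟩ : ∃ q, p = q + 3 := ⟨p - 3, by omega⟩
      have hV' : Fintype.card V = (2 * q + 5) * t := by
        rw [hV, Nat.sub_eq_iff_eq_add ht]
        ring
      have hb : b ≤ 2 * q + 3 := by omega
      rw [hV', show q + 3 - 1 = q + 2 by omega] at hle
      nlinarith [Nat.mul_le_mul_right (Finset.univ.filter fun v => h v ∈ S).card hb,
        Nat.mul_le_mul_left (2 * q + 3) (Nat.succ_le_of_lt hlt)]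
    obtain ⟨e, he, hecard⟩ := Finset.exists_subset_card_eq hcard
    refine ⟨e, Finset.mem_powersetCard.2 ⟨Finset.subset_univ _, hecard⟩, ?_⟩
    rw [← hS]
    refine Finset.card_le_card (Finset.image_subset_iff.2 fun v hv => ?_)
    exact (Finset.mem_filter.1 (he hv)).2
end

section
/- Fix an integer t ≥ 1 and a real number q with 0 < q < 1/(t+1). Let F be a t-intersecting family of subsets of [n]. Then the q-biased measure of F satisfies μ_q(F) = Σ_{S ∈ F} q^{|S|} (1−q)^{n−|S|} ≤ q^t. -/
/-- `F` is a `t`-intersecting family: any two members share at least `t` elements. -/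
def IsIntersectingFamily {α : Type*} [DecidableEq α] (t : ℕ) (F : Finset (Finset α)) : Prop :=
  ∀ A ∈ F, ∀ B ∈ F, t ≤ (A ∩ B).card

open Finset Polynomial

/-- Summing `f #S * ∏ i ∈ S, y i` over subsets takes one forward difference of `f` for every
index at which `y` is `-1`. -/
lemma sum_powerset_union_mul_prod_eq_fwdDiff {ι : Type*} [DecidableEq ι] (y : ι → ℝ)
    (U T : Finset ι) (hTU : Disjoint T U) (hy : ∀ i ∈ T, y i = -1) (f : ℝ → ℝ) :
    ∑ S ∈ (T ∪ U).powerset, f #S * ∏ i ∈ S, y i =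
      (-1) ^ #T * ∑ S ∈ U.powerset, (fwdDiff 1)^[#T] f #S * ∏ i ∈ S, y i := by
  induction T using Finset.induction_on generalizing f with
  | empty => simp
  | insert a T ha ih =>
    rw [disjoint_insert_left] at hTU
    have haW : a ∉ T ∪ U := by simp [ha, hTU.1]
    have hT := ih hTU.2 (fun i hi => hy i (mem_insert_of_mem hi))
    have key : ∀ S ∈ (T ∪ U).powerset,
        f #S * ∏ i ∈ S, y i + f #(insert a S) * ∏ i ∈ insert a S, y i =
          -(fwdDiff 1 f #S * ∏ i ∈ S, y i) := by
      intro S hS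
      have haS : a ∉ S := fun h => haW (mem_powerset.1 hS h)
      rw [card_insert_of_notMem haS, prod_insert haS, hy a (mem_insert_self a T), fwdDiff]
      push_cast
      ring
    rw [insert_union, sum_powerset_insert haW, ← sum_add_distrib, sum_congr rfl key,
      sum_neg_distrib, hT, card_insert_of_notMem ha, Function.iterate_succ_apply, pow_succ]
    ring

lemma sum_eval_card_mul_prod_eq_zero {ι : Type*} [Fintype ι] [DecidableEq ι] (P : ℝ[X])
    (y : ι → ℝ) (T : Finset ι) (hP : P.natDegree < #T) (hy : ∀ i ∈ T, y i = -1) :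
    ∑ S : Finset ι, P.eval (#S : ℝ) * ∏ i ∈ S, y i = 0 := by
  have h := sum_powerset_union_mul_prod_eq_fwdDiff y Tᶜ T disjoint_compl_right hy
    (fun x => P.eval x)
  rw [Polynomial.fwdDiff_iter_eq_zero_of_degree_lt hP, union_compl, powerset_univ] at h
  simpa using h

/-- The absolute value of `(-r) ^ k * P k`, at `k = t + 1 + d`, for the polynomial `P` of degree
less than `t` with `P j = (-r⁻¹) ^ j` for `1 ≤ j ≤ t`. -/
noncomputable def interpolationSum (t d : ℕ) (r : ℝ) : ℝ :=
  ∑ i ∈ range t, ((t + d).descFactorial t : ℝ) /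
    (i.factorial * (t - 1 - i).factorial * ((t + d - i : ℕ) : ℝ)) * r ^ (t + d - i)

lemma interpolationSum_nonneg (t d : ℕ) {r : ℝ} (hr : 0 ≤ r) : 0 ≤ interpolationSum t d r :=
  sum_nonneg fun _ _ => by positivity

lemma interpolationSum_mono (t d : ℕ) {r s : ℝ} (hr : 0 ≤ r) (hrs : r ≤ s) :
    interpolationSum t d r ≤ interpolationSum t d s := by
  unfold interpolationSum
  gcongr

lemma interpolationSum_inv_succ_le (t d : ℕ) (ht : 1 ≤ t) :
    interpolationSum t (d + 1) (t : ℝ)⁻¹ ≤ interpolationSum t d (t : ℝ)⁻¹ := by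
  unfold interpolationSum
  refine sum_le_sum fun i hi => ?_
  obtain ⟨e, rfl⟩ : ∃ e, t = i + 1 + e := Nat.exists_eq_add_of_le (mem_range.1 hi)
  have h1 : i + 1 + e + (d + 1) - i = e + d + 2 := by omega
  have h2 : i + 1 + e + d - i = e + d + 1 := by omega
  have h3 : i + 1 + e - 1 - i = e := by omega
  have hD := Nat.succ_descFactorial (i + 1 + e + d) (i + 1 + e)
  rw [show i + 1 + e + d + 1 - (i + 1 + e) = d + 1 by omega] at hD
  have hD' : ((d : ℝ) + 1) * ((i + 1 + e + (d + 1)).descFactorial (i + 1 + e) : ℕ) =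
      ((i : ℝ) + 1 + e + d + 1) * ((i + 1 + e + d).descFactorial (i + 1 + e) : ℕ) := by
    exact_mod_cast hD
  rw [h1, h2, h3]
  set D' : ℝ := (((i + 1 + e + (d + 1)).descFactorial (i + 1 + e) : ℕ) : ℝ)
  set D : ℝ := (((i + 1 + e + d).descFactorial (i + 1 + e) : ℕ) : ℝ)
  have hD0 : 0 ≤ D := by positivity
  have hDD : D' = ((i : ℝ) + 1 + e + d + 1) * D / (d + 1) := by
    field_simp
    linarith
  rw [hDD]
  push_cast
  have key : ((i : ℝ) + 1 + e + d + 1) * (e + d + 1) ≤ (d + 1) * (e + d + 2) * (i + 1 + e) := by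
    have hi : (0 : ℝ) ≤ i := by positivity
    have he : (0 : ℝ) ≤ e := by positivity
    have hd : (0 : ℝ) ≤ d := by positivity
    have : 0 ≤ (i : ℝ) * e * d := by positivity
    nlinarith [mul_nonneg hi he, mul_nonneg hi hd, mul_nonneg he hd, mul_nonneg he he,
      mul_nonneg hd hd, mul_nonneg (mul_nonneg hi hd) hd, mul_nonneg (mul_nonneg he he) hd,
      mul_nonneg (mul_nonneg he hd) hd]
  have e1 : ((i : ℝ) + 1 + e + d + 1) * D / (d + 1) / (i.factorial * e.factorial * (e + d + 2)) *
      ((i : ℝ) + 1 + e)⁻¹ ^ (e + d + 2) =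
      (D / (i.factorial * e.factorial * (e + d + 1)) * ((i : ℝ) + 1 + e)⁻¹ ^ (e + d + 1)) *
        ((((i : ℝ) + 1 + e + d + 1) * (e + d + 1)) / ((d + 1) * (e + d + 2) * (i + 1 + e))) := by
    rw [pow_succ _ (e + d + 1)]
    field_simp
  rw [e1]
  refine mul_le_of_le_one_right (by positivity) ?_
  rw [div_le_one (by positivity)]
  exact key

lemma interpolationSum_one_inv (t : ℕ) (ht : 1 ≤ t) : interpolationSum t 1 (t : ℝ)⁻¹ = 1 := by
  have partialSum : ∀ m ≤ t, ∑ i ∈ range m, ((t + 1).descFactorial t : ℝ) /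
      (i.factorial * (t - 1 - i).factorial * ((t + 1 - i : ℕ) : ℝ)) * (t : ℝ)⁻¹ ^ (t + 1 - i) =
      m * t.factorial / (m.factorial * (t + 1 - m).factorial) * (t : ℝ)⁻¹ ^ (t + 1 - m) := by
    intro m hm
    induction m with
    | zero => simp
    | succ i ih =>
      rw [sum_range_succ, ih (by omega)]
      obtain ⟨e, rfl⟩ : ∃ e, t = i + 1 + e := Nat.exists_eq_add_of_le hm
      have h1 : i + 1 + e + 1 - i = e + 2 := by omega
      have h2 : i + 1 + e + 1 - (i + 1) = e + 1 := by omega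
      have h3 : i + 1 + e - 1 - i = e := by omega
      have hD : (i + 1 + e + 1).descFactorial (i + 1 + e) =
          (i + 1 + e + 1) * (i + 1 + e).factorial := by
        have := Nat.succ_descFactorial (i + 1 + e) (i + 1 + e)
        rwa [Nat.descFactorial_self, Nat.add_sub_cancel_left, one_mul] at this
      rw [h1, h2, h3, hD, Nat.factorial_succ i, Nat.factorial_succ (e + 1), Nat.factorial_succ e]
      push_cast
      rw [pow_succ _ (e + 1)]
      field_simp
      ring
  rw [interpolationSum, partialSum t le_rfl, Nat.add_sub_cancel_left]
  have : (t.factorial : ℝ) ≠ 0 := by positivity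
  have : (t : ℝ) ≠ 0 := by positivity
  simp
  field_simp

lemma interpolationSum_le_one (t d : ℕ) (ht : 1 ≤ t) {r : ℝ} (hr : 0 ≤ r)
    (hrt : r ≤ (t : ℝ)⁻¹) : interpolationSum t (d + 1) r ≤ 1 := by
  refine (interpolationSum_mono t (d + 1) hr hrt).trans ?_
  induction d with
  | zero => exact (interpolationSum_one_inv t ht).le
  | succ d ih => exact (interpolationSum_inv_succ_le t (d + 1) ht).trans ih

lemma nodalWeight_range_natCast_add_one (t i : ℕ) (hi : i < t) :
    Lagrange.nodalWeight (range t) (fun j : ℕ => (j : ℝ) + 1) i =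
      (-1) ^ (t - 1 - i) / (i.factorial * (t - 1 - i).factorial) := by
  obtain ⟨e, rfl⟩ : ∃ e, t = i + 1 + e := Nat.exists_eq_add_of_le hi
  have hs : (range (i + 1 + e)).erase i = range i ∪ (range e).map (addLeftEmbedding (i + 1)) := by
    ext j
    simp only [mem_erase, mem_range, mem_union, mem_map, addLeftEmbedding_apply]
    constructor
    · rintro ⟨h1, h2⟩
      rcases lt_or_gt_of_ne h1 with h | h
      · exact Or.inl h
      · exact Or.inr ⟨j - (i + 1), by omega, by omega⟩
    · rintro (h | ⟨l, hl, rfl⟩) <;> omega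
  have hd : Disjoint (range i) ((range e).map (addLeftEmbedding (i + 1))) := by
    rw [disjoint_left]
    simp only [mem_range, mem_map, addLeftEmbedding_apply]
    rintro j hj ⟨l, -, rfl⟩
    omega
  have h1 : ∏ j ∈ range i, ((i : ℝ) + 1 - (j + 1)) = i.factorial := by
    rw [← Nat.descFactorial_self, Nat.descFactorial_eq_prod_range, Nat.cast_prod]
    refine prod_congr rfl fun j hj => ?_
    rw [Nat.cast_sub (mem_range.1 hj).le]
    ring
  have h2 : ∏ l ∈ range e, ((i : ℝ) + 1 - (((i + 1 + l : ℕ) : ℝ) + 1)) =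
      (-1) ^ e * e.factorial := by
    rw [← prod_range_add_one_eq_factorial, Nat.cast_prod, ← card_range e, ← prod_const,
      card_range, ← prod_mul_distrib]
    refine prod_congr rfl fun j hj => ?_
    push_cast
    ring
  rw [Lagrange.nodalWeight, prod_inv_distrib, hs, prod_union hd, prod_map]
  simp only [addLeftEmbedding_apply]
  rw [h1, h2, show i + 1 + e - 1 - i = e by omega]
  have : ((-1 : ℝ) ^ e) * (-1) ^ e = 1 := by rw [← mul_pow]; simp
  field_simp
  rw [sq, this]

lemma neg_pow_mul_eval_interpolate (t d : ℕ) {r : ℝ} (hr : r ≠ 0) (m : ℝ) :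
    (-r) ^ (t + 1 + d) * (Lagrange.interpolate (range t) (fun j : ℕ => (j : ℝ) + 1)
      (fun j => m * (-r⁻¹) ^ (j + 1))).eval ((t + 1 + d : ℕ) : ℝ) =
      m * (-1) ^ (d + 1) * interpolationSum t d r := by
  rw [Lagrange.eval_interpolate_not_at_node, Lagrange.eval_nodal, interpolationSum, mul_sum,
    mul_sum, mul_sum]
  · refine sum_congr rfl fun i hi => ?_
    rw [nodalWeight_range_natCast_add_one t i (mem_range.1 hi)]
    have hD : ∏ j ∈ range t, (((t + 1 + d : ℕ) : ℝ) - (j + 1)) =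
        ((t + d).descFactorial t : ℕ) := by
      rw [Nat.descFactorial_eq_prod_range, Nat.cast_prod]
      refine prod_congr rfl fun j hj => ?_
      rw [Nat.cast_sub (by have := mem_range.1 hj; omega)]
      push_cast
      ring
    rw [hD]
    generalize (t + d).descFactorial t = D
    obtain ⟨e, rfl⟩ : ∃ e, t = i + 1 + e := Nat.exists_eq_add_of_le (mem_range.1 hi)
    rw [show i + 1 + e - 1 - i = e by omega, show i + 1 + e + d - i = e + d + 1 by omega]
    have h1 : (((i + 1 + e + 1 + d : ℕ) : ℝ) - (i + 1)) = ((e + d + 1 : ℕ) : ℝ) := by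
      push_cast
      ring
    have h2 : (-r) ^ (i + 1 + e + 1 + d) * (-r⁻¹) ^ (i + 1) =
        (-1) ^ (e + d + 1) * r ^ (e + d + 1) := by
      rw [show i + 1 + e + 1 + d = (e + d + 1) + (i + 1) by omega, pow_add, mul_assoc, ← mul_pow,
        neg_mul_neg, mul_inv_cancel₀ hr, one_pow, mul_one, neg_pow]
    have h3 : ((-1 : ℝ) ^ e) * (-1) ^ e = 1 := by rw [← mul_pow]; simp
    rw [h1]
    calc _ = ((-r) ^ (i + 1 + e + 1 + d) * (-r⁻¹) ^ (i + 1)) *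
          (D * ((-1) ^ e / (i.factorial * e.factorial) * ((e + d + 1 : ℕ) : ℝ)⁻¹ * m)) := by ring
      _ = ((-1) ^ e * (-1) ^ e) * (m * (-1) ^ (d + 1) *
          (D / (i.factorial * e.factorial * ((e + d + 1 : ℕ) : ℝ)) * r ^ (e + d + 1))) := by
        rw [h2, show e + d + 1 = e + (d + 1) by ring, pow_add (-1 : ℝ)]
        field_simp
      _ = _ := by rw [h3, one_mul]
  · intro i hi
    have : i < t := mem_range.1 hi
    have h : t + 1 + d ≠ i + 1 := by omega
    exact_mod_cast h

/-- The polynomial giving the eigenvalues `(-r) ^ k * P k` of the weighted disjointness-type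
operator used in the Hoffman bound. -/
lemma exists_hoffman_polynomial (t : ℕ) (ht : 1 ≤ t) {r : ℝ} (hr : 0 < r) (hrt : r ≤ (t : ℝ)⁻¹) :
    ∃ P : ℝ[X], P.natDegree < t ∧ P.eval 0 = 1 ∧
      ∀ k : ℕ, 1 ≤ k → -((1 + r⁻¹) ^ t - 1)⁻¹ ≤ (-r) ^ k * P.eval (k : ℝ) := by
  have hgt : 1 < (1 + r⁻¹) ^ t := one_lt_pow₀ (by simpa using hr) (by omega)
  set m : ℝ := -((1 + r⁻¹) ^ t - 1)⁻¹ with hm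
  have hm0 : m ≤ 0 := by
    rw [hm, neg_nonpos, inv_nonneg]
    linarith
  have hinj : Set.InjOn (fun j : ℕ => (j : ℝ) + 1) (range t : Set ℕ) := by
    intro a _ b _ h
    simpa using h
  set P := Lagrange.interpolate (range t) (fun j : ℕ => (j : ℝ) + 1)
      (fun j => m * (-r⁻¹) ^ (j + 1)) with hP
  have hdeg : P.natDegree < t := by
    have h := Lagrange.degree_interpolate_lt (r := fun j : ℕ => m * (-r⁻¹) ^ (j + 1)) hinj
    rw [card_range] at h
    rcases eq_or_ne P 0 with h0 | h0
    · rw [h0, natDegree_zero]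
      exact ht
    · exact (natDegree_lt_iff_degree_lt h0).2 h
  have hnode : ∀ j < t, P.eval ((j + 1 : ℕ) : ℝ) = m * (-r⁻¹) ^ (j + 1) := by
    intro j hj
    have := Lagrange.eval_interpolate_at_node (fun j => m * (-r⁻¹) ^ (j + 1)) hinj
      (mem_range.2 hj)
    rwa [← Nat.cast_add_one] at this
  refine ⟨P, hdeg, ?_, ?_⟩
  · have h := sum_eval_card_mul_prod_eq_zero P (fun _ : Fin t => (-1 : ℝ)) univ (by simpa)
      (by simp)
    simp only [prod_const] at h
    rw [← powerset_univ, sum_powerset_apply_card (fun j => P.eval (j : ℝ) * (-1) ^ j),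
      card_univ, Fintype.card_fin, sum_range_succ'] at h
    have hb : ∑ j ∈ range t, (r⁻¹) ^ (j + 1) * (t.choose (j + 1) : ℝ) = (1 + r⁻¹) ^ t - 1 := by
      rw [add_comm 1, add_pow, sum_range_succ']
      simp
    have hs : ∑ j ∈ range t, t.choose (j + 1) • (P.eval ((j + 1 : ℕ) : ℝ) * (-1) ^ (j + 1)) =
        m * ((1 + r⁻¹) ^ t - 1) := by
      rw [← hb, mul_sum]
      refine sum_congr rfl fun j hj => ?_
      rw [hnode j (mem_range.1 hj), mul_assoc, ← mul_pow, nsmul_eq_mul]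
      simp
      ring
    rw [hs, hm, neg_mul, inv_mul_cancel₀ (by linarith)] at h
    simp at h
    linarith
  · intro k hk
    rcases le_or_gt k t with hkt | hkt
    · obtain ⟨j, rfl⟩ : ∃ j, k = j + 1 := ⟨k - 1, by omega⟩
      rw [hnode j (by omega), mul_left_comm, ← mul_pow, neg_mul_neg, mul_inv_cancel₀ hr.ne']
      simp
    · obtain ⟨d, rfl⟩ : ∃ d, k = t + 1 + d := Nat.exists_eq_add_of_le hkt
      rw [hP, neg_pow_mul_eval_interpolate t d hr.ne']
      have ha := interpolationSum_nonneg t d hr.le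
      rcases Nat.even_or_odd d with hd | hd
      · rw [hd.add_one.neg_one_pow]
        nlinarith
      · rw [hd.add_one.neg_one_pow]
        obtain ⟨l, rfl⟩ := hd
        have := interpolationSum_le_one t (2 * l) ht hr.le hrt
        nlinarith

/-- Parseval's identity for the biased characters, in product form. -/
lemma sum_prod_biasedCharacter {n : ℕ} {p q : ℝ} (hp : p ≠ 0) (hq : q ≠ 0) (hpq : p + q = 1)
    (A B : Finset (Fin n)) :
    ∑ S : Finset (Fin n), ∏ i ∈ S,
        ((if i ∈ A then p else -q) * (if i ∈ B then p else -q) / (p * q)) =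
      if A = B then (q ^ #A * p ^ (n - #A))⁻¹ else 0 := by
  rw [← powerset_univ, ← prod_one_add]
  split_ifs with h
  · subst h
    have : q ^ #A * p ^ (n - #A) = ∏ i : Fin n, if i ∈ A then q else p := by
      rw [prod_ite, prod_const, prod_const, filter_mem_eq_inter, univ_inter, filter_not,
        filter_mem_eq_inter, univ_inter, ← compl_eq_univ_sdiff, card_compl, Fintype.card_fin]
    rw [this, ← prod_inv_distrib]
    refine prod_congr rfl fun i _ => ?_
    split_ifs
    · field_simp
      linarith
    · field_simp
      linarith
  · obtain ⟨i, hi⟩ : ∃ i, ¬ (i ∈ A ↔ i ∈ B) := by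
      by_contra! hc
      exact h (Finset.ext hc)
    refine prod_eq_zero (mem_univ i) ?_
    by_cases hA : i ∈ A <;> by_cases hB : i ∈ B <;> simp [hA, hB] at hi ⊢ <;> field_simp <;> ring

/-- Dinur–Safra / Friedgut: for `t ≥ 1` and `0 < q < 1/(t+1)`, every `t`-intersecting
family `F` of subsets of `[n]` has `q`-biased measure at most `q^t`:
`∑_{S ∈ F} q^|S| (1-q)^{n-|S|} ≤ q^t`. -/
theorem biased_measure_le_of_intersecting
    (t : ℕ) (ht : 1 ≤ t) (q : ℝ) (hq0 : 0 < q) (hq1 : q < 1 / (t + 1))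
    (n : ℕ) (F : Finset (Finset (Fin n))) (hF : IsIntersectingFamily t F) :
    ∑ S ∈ F, q ^ S.card * (1 - q) ^ (n - S.card) ≤ q ^ t := by
  have ht0 : (0 : ℝ) < t := by exact_mod_cast ht
  rw [lt_div_iff₀ (by positivity)] at hq1
  obtain ⟨p, hp⟩ : ∃ p, p = 1 - q := ⟨_, rfl⟩
  rw [← hp]
  have hp0 : 0 < p := by nlinarith
  have hpq : p + q = 1 := by linarith
  have hrt : q / p ≤ (t : ℝ)⁻¹ := by
    rw [div_le_iff₀ hp0, inv_mul_eq_div, le_div_iff₀ ht0]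
    linarith
  obtain ⟨P, hdeg, hP0, hPk⟩ := exists_hoffman_polynomial t ht (div_pos hq0 hp0) hrt
  have hqt : q ^ t < 1 := pow_lt_one₀ hq0.le (by linarith) (by omega)
  have hqt0 : 0 < q ^ t := by positivity
  have hmv : ((1 + (q / p)⁻¹) ^ t - 1)⁻¹ = q ^ t / (1 - q ^ t) := by
    have : 1 + (q / p)⁻¹ = q⁻¹ := by
      field_simp
      linarith
    rw [this, inv_pow]
    have : 1 - q ^ t ≠ 0 := by linarith
    have : (q ^ t)⁻¹ - 1 = (1 - q ^ t) / q ^ t := by field_simp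
    rw [this, inv_div]
  rw [hmv] at hPk
  set w : Finset (Fin n) → ℝ := fun A => q ^ #A * p ^ (n - #A) with hw
  have hw0 : ∀ A, 0 < w A := fun A => by positivity
  set v : Finset (Fin n) → Fin n → ℝ := fun A i => if i ∈ A then p else -q with hv
  set c : Finset (Fin n) → ℝ := fun S => (∑ A ∈ F, w A * ∏ i ∈ S, v A i) ^ 2 / (p * q) ^ #S with hc
  have hc0 : ∀ S, 0 ≤ c S := fun S => by positivity
  have hcexp : ∀ S, c S = ∑ A ∈ F, ∑ B ∈ F, w A * w B * ∏ i ∈ S, (v A i * v B i / (p * q)) := by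
    intro S
    simp only [hc]
    rw [sq, sum_mul_sum, sum_div]
    refine sum_congr rfl fun A _ => ?_
    rw [sum_div]
    refine sum_congr rfl fun B _ => ?_
    rw [prod_div_distrib, prod_mul_distrib, prod_const]
    ring
  have hswap : ∀ g : Finset (Fin n) → ℝ, ∑ S, g S * c S =
      ∑ A ∈ F, ∑ B ∈ F, w A * w B * ∑ S, g S * ∏ i ∈ S, (v A i * v B i / (p * q)) := by
    intro g
    simp only [hcexp, mul_sum]
    rw [sum_comm]
    refine sum_congr rfl fun A _ => ?_
    rw [sum_comm]
    refine sum_congr rfl fun B _ => sum_congr rfl fun S _ => ?_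
    ring
  have hempty : c ∅ = (∑ A ∈ F, w A) ^ 2 := by simp [hc]
  have hparseval : ∑ S, c S = ∑ A ∈ F, w A := by
    have h := hswap 1
    simp only [Pi.one_apply, one_mul] at h
    rw [h]
    refine sum_congr rfl fun A hA => ?_
    simp only [hv, sum_prod_biasedCharacter hp0.ne' hq0.ne' hpq]
    rw [sum_eq_single_of_mem A hA (fun B _ hBA => by simp [hBA.symm]), if_pos rfl]
    exact mul_inv_cancel_right₀ (hw0 A).ne' _
  have hzero : ∑ S : Finset (Fin n), ((-(q / p)) ^ #S * P.eval (#S : ℝ)) * c S = 0 := by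
    rw [hswap]
    refine sum_eq_zero fun A hA => sum_eq_zero fun B hB => mul_eq_zero_of_right _ ?_
    rw [← sum_eval_card_mul_prod_eq_zero P (fun i => -(q / p) * (v A i * v B i / (p * q)))
      (A ∩ B) (hdeg.trans_le (hF A hA B hB))]
    · refine sum_congr rfl fun S _ => ?_
      rw [prod_mul_distrib, prod_const]
      ring
    · intro i hi
      rw [mem_inter] at hi
      simp only [hv, if_pos hi.1, if_pos hi.2]
      field_simp
  have hbound : ∑ S ∈ univ.erase ∅, -(q ^ t / (1 - q ^ t)) * c S ≤
      ∑ S ∈ univ.erase ∅, ((-(q / p)) ^ #S * P.eval (#S : ℝ)) * c S := by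
    refine sum_le_sum fun S hS => mul_le_mul_of_nonneg_right (hPk _ ?_) (hc0 S)
    exact card_pos.2 (nonempty_iff_ne_empty.2 (ne_of_mem_erase hS))
  rw [← add_sum_erase _ _ (mem_univ ∅)] at hzero hparseval
  rw [← mul_sum] at hbound
  simp only [card_empty, pow_zero, Nat.cast_zero, hP0, one_mul] at hzero
  set μ := ∑ A ∈ F, w A
  have hmain : μ ^ 2 ≤ q ^ t / (1 - q ^ t) * (μ - μ ^ 2) := by
    have : ∑ S ∈ univ.erase ∅, c S = μ - μ ^ 2 := by linarith
    rw [this] at hbound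
    linarith
  rw [div_mul_eq_mul_div, le_div_iff₀ (by linarith)] at hmain
  have hμ : 0 ≤ μ := sum_nonneg fun A _ => (hw0 A).le
  nlinarith
end

section
/- Fix an integer t ≥ 1 and a real number q with 0 < q < 1/(t+1). Let F be a t-intersecting family of subsets of [n]. Then the probability that a q-biased random subset of [n] contains some member of F is at most q^t; explicitly, Σ_{S ⊆ [n] : ∃ A ∈ F with A ⊆ S} q^{|S|} (1−q)^{n−|S|} ≤ q^t. -/
open Polynomial

section AlternatingSums

/-- Partial sums of an alternating series with nonnegative antitone terms are nonnegative. -/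
lemma Antitone.alternating_sum_range_mem_Icc {e : ℕ → ℝ} (he : Antitone e) (h0 : ∀ i, 0 ≤ e i)
    (n : ℕ) : ∑ i ∈ Finset.range n, (-1) ^ i * e i ∈ Set.Icc 0 (e 0) := by
  induction n generalizing e with
  | zero => simpa using h0 0
  | succ n ih =>
    have h := ih (e := fun i => e (i + 1)) (fun i j hij => he (by omega)) (fun i => h0 _)
    have h1 : e 1 ≤ e 0 := he (by omega)
    rw [Finset.sum_range_succ']
    have h2 : ∑ i ∈ Finset.range n, (-1 : ℝ) ^ (i + 1) * e (i + 1)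
        = -∑ i ∈ Finset.range n, (-1 : ℝ) ^ i * e (i + 1) := by
      rw [← Finset.sum_neg_distrib]
      exact Finset.sum_congr rfl fun i _ => by ring
    rw [h2]
    simp only [Set.mem_Icc, zero_add, pow_zero, one_mul] at h ⊢
    constructor <;> linarith [h.1, h.2]

lemma antitone_choose_mul_pow {k : ℕ} {r : ℝ} (hr : 0 ≤ r) (hkr : (k + 1) * r ≤ 1) :
    Antitone fun i : ℕ => ((k + i).choose k : ℝ) * r ^ i := by
  refine antitone_nat_of_succ_le fun i => ?_
  have hc : ((k + i).choose k : ℝ) * (k + i + 1) = ((k + (i + 1)).choose k : ℝ) * (i + 1) := by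
    have h := Nat.choose_mul_succ_eq (k + i) k
    rw [show k + i + 1 - k = i + 1 by omega] at h
    exact_mod_cast h
  have hi : (0 : ℝ) < i + 1 := by positivity
  have hk : (k + i + 1 : ℝ) * r ≤ i + 1 := by
    have : (k + i + 1 : ℝ) ≤ (k + 1) * (i + 1) := by
      nlinarith [mul_nonneg (Nat.cast_nonneg (α := ℝ) k) (Nat.cast_nonneg (α := ℝ) i)]
    nlinarith
  refine le_of_mul_le_mul_right ?_ hi
  calc ((k + (i + 1)).choose k : ℝ) * r ^ (i + 1) * (i + 1)
      = ((k + (i + 1)).choose k : ℝ) * (i + 1) * (r ^ i * r) := by ring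
    _ = ((k + i).choose k : ℝ) * r ^ i * ((k + i + 1) * r) := by rw [← hc]; ring
    _ ≤ ((k + i).choose k : ℝ) * r ^ i * (i + 1) := by gcongr

end AlternatingSums

section TruncatedTaylor

/-- The value at `1` of the Taylor polynomial of degree less than `t` at `-r`, that is, of the
remainder modulo `(X + r) ^ t`. -/
noncomputable def truncTaylorEvalOne (r : ℝ) (t : ℕ) : ℝ[X] →ₗ[ℝ] ℝ :=
  ∑ i ∈ Finset.range t, (1 + r) ^ i • (lcoeff ℝ i ∘ₗ taylor (-r))

lemma truncTaylorEvalOne_apply (r : ℝ) (t : ℕ) (p : ℝ[X]) :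
    truncTaylorEvalOne r t p = ∑ i ∈ Finset.range t, (1 + r) ^ i * (taylor (-r) p).coeff i := by
  simp [truncTaylorEvalOne, LinearMap.sum_apply]

lemma truncTaylorEvalOne_X_add_C_pow_mul (r : ℝ) (t : ℕ) (p : ℝ[X]) :
    truncTaylorEvalOne r t ((X + C r) ^ t * p) = 0 := by
  rw [truncTaylorEvalOne_apply]
  refine Finset.sum_eq_zero fun i hi => ?_
  have h : taylor (-r) ((X + C r) ^ t * p) = X ^ t * taylor (-r) p := by
    rw [taylor_mul, taylor_pow]
    simp
  rw [h, coeff_X_pow_mul', if_neg (by simpa using hi), mul_zero]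

lemma truncTaylorEvalOne_of_natDegree_lt {r : ℝ} {t : ℕ} {p : ℝ[X]} (hp : p.natDegree < t) :
    truncTaylorEvalOne r t p = p.eval 1 := by
  have h := taylor_eval (-r) p (1 + r)
  rw [eval_eq_sum_range' (n := t) (by rwa [natDegree_taylor])] at h
  rw [truncTaylorEvalOne_apply, show (1 : ℝ) = 1 + r + -r by ring, ← h]
  refine Finset.sum_congr rfl fun i _ => ?_
  ring_nf

lemma truncTaylorEvalOne_X_mul (r : ℝ) (k : ℕ) (p : ℝ[X]) :
    truncTaylorEvalOne r (k + 1) (X * p)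
      = truncTaylorEvalOne r (k + 1) p - (1 + r) ^ (k + 1) * (taylor (-r) p).coeff k := by
  simp only [truncTaylorEvalOne_apply, taylor_mul, taylor_X]
  generalize taylor (-r) p = g
  induction k with
  | zero => simp [add_mul]
  | succ k ih =>
    rw [Finset.sum_range_succ, ih, Finset.sum_range_succ _ (k + 1), add_mul, coeff_add,
      coeff_X_mul, coeff_C_mul]
    ring

lemma truncTaylorEvalOne_X_pow (r : ℝ) (k n : ℕ) :
    truncTaylorEvalOne r (k + 1) (X ^ (k + n))
      = 1 - (1 + r) ^ (k + 1)
          * ∑ i ∈ Finset.range n, (-1) ^ i * (((k + i).choose k : ℝ) * r ^ i) := by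
  induction n with
  | zero => rw [truncTaylorEvalOne_of_natDegree_lt (by simp)]; simp
  | succ n ih =>
    rw [← add_assoc, pow_succ', truncTaylorEvalOne_X_mul, ih, taylor_pow, taylor_X,
      coeff_X_add_C_pow, Finset.sum_range_succ, Nat.add_sub_cancel_left, neg_pow]
    ring

lemma truncTaylorEvalOne_X_pow_le_one {r : ℝ} {t : ℕ} (ht : 1 ≤ t) (hr : 0 ≤ r)
    (htr : t * r ≤ 1) (m : ℕ) : truncTaylorEvalOne r t (X ^ m) ≤ 1 := by
  obtain ⟨k, rfl⟩ := Nat.exists_eq_add_of_le' ht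
  rcases lt_or_ge m (k + 1) with hm | hm
  · rw [truncTaylorEvalOne_of_natDegree_lt (by simpa using hm)]
    simp
  · obtain ⟨n, rfl⟩ := Nat.exists_eq_add_of_le (Nat.le_of_succ_le hm)
    rw [truncTaylorEvalOne_X_pow]
    have h := ((antitone_choose_mul_pow hr (by exact_mod_cast htr)).alternating_sum_range_mem_Icc
      (fun i => by positivity) n).1
    have : 0 ≤ (1 + r) ^ (k + 1) := by positivity
    nlinarith [mul_nonneg this h]

lemma truncTaylorEvalOne_le_eval_one {r : ℝ} {t : ℕ} (ht : 1 ≤ t) (hr : 0 ≤ r)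
    (htr : t * r ≤ 1) {p : ℝ[X]} (hp : ∀ i, 0 ≤ p.coeff i) :
    truncTaylorEvalOne r t p ≤ p.eval 1 := by
  rw [eval_eq_sum_range]
  conv_lhs => rw [p.as_sum_range_C_mul_X_pow, map_sum]
  refine Finset.sum_le_sum fun i _ => ?_
  rw [← smul_eq_C_mul, map_smul, smul_eq_mul, one_pow]
  exact mul_le_mul_of_nonneg_left (truncTaylorEvalOne_X_pow_le_one ht hr htr i) (hp i)

lemma truncTaylorEvalOne_divX {r : ℝ} {t : ℕ} (ht : 1 ≤ t) (p : ℝ[X]) :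
    truncTaylorEvalOne r t ((X + C r) ^ t * p).divX = p.coeff 0 * ((1 + r) ^ t - r ^ t) := by
  set A : ℝ[X] := (X + C r) ^ t with hA
  have hA0 : A.coeff 0 = r ^ t := by simp [hA, coeff_X_add_C_pow]
  have h1 : A * p = A * p.divX * X + C (p.coeff 0) * A := by
    conv_lhs => rw [← divX_mul_X_add p]
    ring
  have h2 : (A * p).divX = A * p.divX + C (p.coeff 0) * A.divX := by
    rw [h1, divX_add]
    congr 1
    · ext n; simp [coeff_divX, coeff_mul_X]
    · ext n; simp [coeff_divX]
  have h3 : A.divX.natDegree < t := by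
    rw [natDegree_divX_eq_natDegree_tsub_one, hA, natDegree_pow, natDegree_X_add_C]
    omega
  have h4 : A.divX.eval 1 = (1 + r) ^ t - r ^ t := by
    have h := congrArg (eval 1) (divX_mul_X_add A)
    rw [hA0] at h
    have h5 : A.eval 1 = (1 + r) ^ t := by simp [hA]
    simp only [eval_add, eval_mul, eval_X, eval_C, h5] at h
    linarith
  rw [h2, map_add, hA, truncTaylorEvalOne_X_add_C_pow_mul, ← hA, ← smul_eq_C_mul, map_smul,
    truncTaylorEvalOne_of_natDegree_lt h3, h4, smul_eq_mul, zero_add]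

/-- The one-variable form of the Hoffman bound. -/
lemma coeff_zero_mul_le_of_X_add_C_pow_dvd {r : ℝ} {t : ℕ} (ht : 1 ≤ t) (hr : 0 ≤ r)
    (htr : t * r ≤ 1) {p : ℝ[X]} (hp : ∀ i, 0 ≤ p.coeff i) (hdvd : (X + C r) ^ t ∣ p) :
    p.coeff 0 * (1 + r) ^ t ≤ p.eval 1 * r ^ t := by
  obtain ⟨g, rfl⟩ := hdvd
  have h := truncTaylorEvalOne_le_eval_one ht hr htr
    (p := ((X + C r) ^ t * g).divX) (fun i => by rw [coeff_divX]; exact hp _)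
  rw [truncTaylorEvalOne_divX ht] at h
  have h0 : ((X + C r) ^ t * g).coeff 0 = r ^ t * g.coeff 0 := by
    rw [mul_coeff_zero]; simp [coeff_X_add_C_pow]
  have h1 := congrArg (eval 1) (divX_mul_X_add ((X + C r) ^ t * g))
  rw [h0] at h1 ⊢
  rw [eval_add, eval_mul, eval_X, eval_C, mul_one] at h1
  have hrt : 0 ≤ r ^ t := by positivity
  nlinarith [mul_le_mul_of_nonneg_right h hrt]

end TruncatedTaylor

section Noise

variable {α : Type*} [DecidableEq α]

/-- The expectation of `f` at a `q`-biased random subset of `s`. -/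
noncomputable def biasedExpectation (q : ℝ) (s : Finset α) (f : Finset α → ℝ) : ℝ :=
  ∑ S ∈ s.powerset, q ^ S.card * (1 - q) ^ (s.card - S.card) * f S

lemma biasedExpectation_insert (q : ℝ) {s : Finset α} {a : α} (ha : a ∉ s)
    (f : Finset α → ℝ) :
    biasedExpectation q (insert a s) f
      = biasedExpectation q s fun S => q * f (insert a S) + (1 - q) * f S := by
  simp only [biasedExpectation]
  rw [Finset.sum_powerset_insert ha, ← Finset.sum_add_distrib]
  refine Finset.sum_congr rfl fun S hS => ?_
  rw [Finset.mem_powerset] at hS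
  have hc := Finset.card_le_card hS
  rw [Finset.card_insert_of_notMem ha, Finset.card_insert_of_notMem fun h => ha (hS h),
    Nat.add_sub_add_right, Nat.sub_add_comm hc]
  ring

/-- The joint law of two `q`-biased bits with correlation `X`. -/
noncomputable def correlatedBits (q : ℝ) (x y : Prop) [Decidable x] [Decidable y] : ℝ[X] :=
  if x then
    if y then C (q ^ 2) + C (q * (1 - q)) * X else C (q * (1 - q)) * (1 - X)
  else
    if y then C (q * (1 - q)) * (1 - X) else C ((1 - q) ^ 2) + C (q * (1 - q)) * X

/-- The expectation of `f S * f T` for `X`-correlated `q`-biased random subsets `S`, `T` of `s`,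
as a polynomial in the correlation `X`. -/
noncomputable def noisePolynomial (q : ℝ) (s : Finset α) (f : Finset α → ℝ) : ℝ[X] :=
  ∑ S ∈ s.powerset, ∑ T ∈ s.powerset,
    C (f S * f T) * ∏ i ∈ s, correlatedBits q (i ∈ S) (i ∈ T)

lemma noisePolynomial_insert (q : ℝ) {s : Finset α} {a : α} (ha : a ∉ s) (f : Finset α → ℝ) :
    noisePolynomial q (insert a s) f
      = noisePolynomial q s (fun S => q * f (insert a S) + (1 - q) * f S)
        + C (q * (1 - q)) * X * noisePolynomial q s (fun S => f (insert a S) - f S) := by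
  simp only [noisePolynomial]
  rw [Finset.sum_powerset_insert ha, ← Finset.sum_add_distrib, Finset.mul_sum,
    ← Finset.sum_add_distrib]
  refine Finset.sum_congr rfl fun S hS => ?_
  rw [Finset.sum_powerset_insert ha, Finset.sum_powerset_insert ha, ← Finset.sum_add_distrib,
    ← Finset.sum_add_distrib, ← Finset.sum_add_distrib, Finset.mul_sum,
    ← Finset.sum_add_distrib]
  refine Finset.sum_congr rfl fun T hT => ?_
  rw [Finset.mem_powerset] at hS hT
  have haS : a ∉ S := fun h => ha (hS h)
  have haT : a ∉ T := fun h => ha (hT h)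
  have hmem : ∀ i ∈ s, ∀ U : Finset α, (i ∈ insert a U) = (i ∈ U) := fun i hi U => by
    rw [Finset.mem_insert, eq_iff_iff, or_iff_right]
    rintro rfl
    exact ha hi
  have e1 : ∏ i ∈ s, correlatedBits q (i ∈ insert a S) (i ∈ insert a T)
      = ∏ i ∈ s, correlatedBits q (i ∈ S) (i ∈ T) :=
    Finset.prod_congr rfl fun i hi => by simp only [hmem i hi]
  have e2 : ∏ i ∈ s, correlatedBits q (i ∈ insert a S) (i ∈ T)
      = ∏ i ∈ s, correlatedBits q (i ∈ S) (i ∈ T) :=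
    Finset.prod_congr rfl fun i hi => by simp only [hmem i hi]
  have e3 : ∏ i ∈ s, correlatedBits q (i ∈ S) (i ∈ insert a T)
      = ∏ i ∈ s, correlatedBits q (i ∈ S) (i ∈ T) :=
    Finset.prod_congr rfl fun i hi => by simp only [hmem i hi]
  rw [Finset.prod_insert ha, Finset.prod_insert ha, Finset.prod_insert ha, Finset.prod_insert ha,
    e1, e2, e3]
  simp only [correlatedBits, haS, haT, Finset.mem_insert_self, if_true, if_false, map_mul, map_add,
    map_sub, map_one, map_pow]
  ring

lemma noisePolynomial_coeff_nonneg {q : ℝ} (hq : 0 ≤ q * (1 - q)) (s : Finset α)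
    (f : Finset α → ℝ) (k : ℕ) : 0 ≤ (noisePolynomial q s f).coeff k := by
  induction s using Finset.induction_on generalizing f k with
  | empty =>
    simp only [noisePolynomial, Finset.powerset_empty, Finset.sum_singleton, Finset.prod_empty,
      mul_one, coeff_C]
    split_ifs
    exacts [mul_self_nonneg _, le_rfl]
  | insert a s ha ih =>
    rw [noisePolynomial_insert q ha, coeff_add, mul_assoc, coeff_C_mul]
    refine add_nonneg (ih _ _) (mul_nonneg hq ?_)
    cases k with
    | zero => simp
    | succ k => rw [coeff_X_mul]; exact ih _ _

lemma noisePolynomial_coeff_zero (q : ℝ) (s : Finset α) (f : Finset α → ℝ) :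
    (noisePolynomial q s f).coeff 0 = biasedExpectation q s f ^ 2 := by
  induction s using Finset.induction_on generalizing f with
  | empty => simp [noisePolynomial, biasedExpectation, sq]
  | insert a s ha ih =>
    rw [noisePolynomial_insert q ha, coeff_add, ih, biasedExpectation_insert q ha]
    simp [mul_assoc]

lemma noisePolynomial_eval_one (q : ℝ) (s : Finset α) (f : Finset α → ℝ) :
    (noisePolynomial q s f).eval 1 = biasedExpectation q s fun S => f S ^ 2 := by
  induction s using Finset.induction_on generalizing f with
  | empty => simp [noisePolynomial, biasedExpectation, sq]
  | insert a s ha ih =>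
    rw [noisePolynomial_insert q ha, eval_add, eval_mul, ih, ih, biasedExpectation_insert q ha]
    simp only [biasedExpectation, eval_mul, eval_C, eval_X, mul_one]
    rw [Finset.mul_sum, ← Finset.sum_add_distrib]
    exact Finset.sum_congr rfl fun S _ => by ring

lemma X_add_C_pow_dvd_noisePolynomial {q : ℝ} (hq : 1 - q ≠ 0) {t : ℕ} (s : Finset α)
    {f : Finset α → ℝ} (hf : ∀ S T, f S ≠ 0 → f T ≠ 0 → t ≤ (S ∩ T).card) :
    (X + C (q / (1 - q))) ^ t ∣ noisePolynomial q s f := by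
  refine Finset.dvd_sum fun S hS => Finset.dvd_sum fun T hT => ?_
  by_cases hST : f S * f T = 0
  · simp [hST]
  obtain ⟨hS0, hT0⟩ := mul_ne_zero_iff.mp hST
  refine Dvd.dvd.mul_left ?_ _
  have hsub : S ∩ T ⊆ s := Finset.inter_subset_left.trans (Finset.mem_powerset.mp hS)
  refine (pow_dvd_pow _ (hf S T hS0 hT0)).trans
    (dvd_trans ?_ (Finset.prod_dvd_prod_of_subset _ _ _ hsub))
  rw [← Finset.prod_const]
  refine Finset.prod_dvd_prod_of_dvd _ _ fun i hi => ⟨C (q * (1 - q)), ?_⟩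
  obtain ⟨hiS, hiT⟩ := Finset.mem_inter.mp hi
  rw [correlatedBits, if_pos hiS, if_pos hiT, add_mul, ← C_mul,
    show q / (1 - q) * (q * (1 - q)) = q ^ 2 by field_simp]
  ring

end Noise

/-- Corollary 1: for `t ≥ 1` and `0 < q < 1/(t+1)`, the probability that a `q`-biased
random subset of `[n]` contains a member of a `t`-intersecting family `F` is at most
`q^t`. -/
theorem biased_upward_closure_le_of_intersecting
    (t : ℕ) (ht : 1 ≤ t) (q : ℝ) (hq0 : 0 < q) (hq1 : q < 1 / (t + 1))
    (n : ℕ) (F : Finset (Finset (Fin n))) (hF : IsIntersectingFamily t F) :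
    ∑ S ∈ (Finset.univ : Finset (Finset (Fin n))).filter (fun S => ∃ A ∈ F, A ⊆ S),
      q ^ S.card * (1 - q) ^ (n - S.card) ≤ q ^ t := by
  have hqt : q * (t + 1) < 1 := (lt_div_iff₀ (by positivity)).mp hq1
  have ht' : (1 : ℝ) ≤ t := by exact_mod_cast ht
  have hq : 0 < 1 - q := by nlinarith
  set f : Finset (Fin n) → ℝ := fun S => if ∃ A ∈ F, A ⊆ S then 1 else 0 with hf
  have hμ : ∑ S ∈ (Finset.univ : Finset (Finset (Fin n))).filter (fun S => ∃ A ∈ F, A ⊆ S),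
      q ^ S.card * (1 - q) ^ (n - S.card) = biasedExpectation q Finset.univ f := by
    simp [biasedExpectation, hf, Finset.sum_filter]
  have hf2 : (fun S => f S ^ 2) = f := by
    funext S
    simp [hf]
  have hdvd : (X + C (q / (1 - q))) ^ t ∣ noisePolynomial q Finset.univ f := by
    refine X_add_C_pow_dvd_noisePolynomial hq.ne' _ fun S T hS hT => ?_
    simp only [hf, ne_eq, ite_eq_right_iff, one_ne_zero, imp_false, not_not] at hS hT
    obtain ⟨A, hA, hAS⟩ := hS
    obtain ⟨B, hB, hBT⟩ := hT
    exact (hF A hA B hB).trans (Finset.card_le_card (Finset.inter_subset_inter hAS hBT))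
  have hmain := coeff_zero_mul_le_of_X_add_C_pow_dvd ht (div_nonneg hq0.le hq.le)
    (by rw [← mul_div_assoc, div_le_one hq]; nlinarith)
    (noisePolynomial_coeff_nonneg (mul_nonneg hq0.le hq.le) Finset.univ f) hdvd
  rw [noisePolynomial_coeff_zero, noisePolynomial_eval_one, hf2,
    show 1 + q / (1 - q) = 1 / (1 - q) by field_simp; ring, div_pow, div_pow, one_pow,
    mul_one_div, ← mul_div_assoc, div_le_div_iff_of_pos_right (by positivity)] at hmain
  rw [hμ]
  by_contra! h
  have hpos : 0 < biasedExpectation q Finset.univ f := lt_trans (by positivity) h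
  nlinarith
end
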